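/- arXiv:2210.09047 — 5 statements merged into one kernel-verified Lean document; each statement's English description precedes it below -/
import Mathlib

section
/- Let X and Y be real random variables with finite expectation and continuous cumulative distribution functions. If Δ_n(X) = Δ_n(Y) for every integer n ≥ 1, then X and Y have the same law up to translation, i.e. there is a constant c ∈ ℝ such that Y has the same distribution as X + c. -/
open MeasureTheory Set

namespace TsallisAux

open Filter Topology ProbabilityTheory

/-- Integrability of `F (1 - F)` for an integrable random variable. -/
lemma integrable_weight {Ω : Type*} [MeasurableSpace Ω] (P : Measure Ω) [IsProbabilityMeasure P]
    (X : Ω → ℝ) (hXm : Measurable X) (hXint : Integrable X P) (F : ℝ → ℝ)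
    (hF : ∀ x, F x = (P {ω | X ω ≤ x}).toReal) (hFcont : Continuous F) :
    Integrable (fun x => F x * (1 - F x)) := by
  have hF0 : ∀ x, 0 ≤ F x := fun x => by rw [hF]; exact ENNReal.toReal_nonneg
  have hF1 : ∀ x, F x ≤ 1 := fun x => by rw [hF]; exact measureReal_le_one
  set h : ℝ → ℝ := fun t => P.real {ω | t ≤ |X ω|} with hh
  have hanti : Antitone h := by
    intro s t hst
    refine measureReal_mono (fun ω hω => ?_)
    exact le_trans hst hω
  have hfin : ∫⁻ t in Ioi (0:ℝ), P {ω | t ≤ |X ω|} < ⊤ := by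
    rw [← lintegral_eq_lintegral_meas_le P (f := fun ω => |X ω|)
      (ae_of_all _ fun ω => abs_nonneg _) hXm.abs.aemeasurable]
    exact hXint.abs.lintegral_lt_top
  have hint : IntegrableOn h (Ioi 0) := by
    refine ⟨hanti.measurable.aestronglyMeasurable, ?_⟩
    rw [hasFiniteIntegral_iff_ofReal (ae_of_all _ fun t => measureReal_nonneg)]
    simpa [hh] using hfin
  have i1 : IntegrableOn (fun x => h |x|) (Ioi 0) := by
    refine hint.congr_fun (fun x hx => ?_) measurableSet_Ioi
    rw [abs_of_pos hx]
  have i2 : IntegrableOn (fun x => h |x|) (Iic 0) := by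
    rw [integrableOn_Iic_iff_integrableOn_Iio]
    have := IntegrableOn.comp_neg_Iio (c := (0:ℝ)) (f := fun x => h |x|) (by simpa using i1)
    simpa using this
  have i3 : Integrable (fun x => h |x|) := by
    rw [← integrableOn_univ, ← Iic_union_Ioi (a := (0:ℝ))]
    exact i2.union i1
  refine i3.mono' (by fun_prop) (ae_of_all _ fun x => ?_)
  rw [Real.norm_of_nonneg (mul_nonneg (hF0 x) (by linarith [hF1 x]))]
  rcases le_or_gt x 0 with hx | hx
  · have : F x ≤ h |x| := by
      rw [hF]
      refine measureReal_mono (fun ω hω => ?_)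
      simp only [mem_ofPred_eq] at hω ⊢
      rw [abs_of_nonpos hx, abs_of_nonpos (hω.trans hx)]
      linarith
    nlinarith [hF0 x, hF1 x]
  · have : 1 - F x ≤ h |x| := by
      have hc : 1 - F x = P.real {ω | X ω ≤ x}ᶜ := by
        rw [probReal_compl_eq_one_sub (measurableSet_le hXm measurable_const), hF]; rfl
      rw [hc]
      refine measureReal_mono (fun ω hω => ?_)
      simp only [mem_compl_iff, mem_ofPred_eq, not_le] at hω ⊢
      rw [abs_of_pos hx, abs_of_pos (hx.trans hω)]
      exact hω.le
    nlinarith [hF0 x, hF1 x]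

/-- The generalized inverse. -/
lemma exists_quantile (F : ℝ → ℝ) (hm : Monotone F) (hc : Continuous F)
    (h0 : Tendsto F atBot (𝓝 0)) (h1 : Tendsto F atTop (𝓝 1)) (u : ℝ) (hu : u ∈ Ioo (0:ℝ) 1) :
    ∃ q, ∀ x, F x ≤ u ↔ x ≤ q := by
  have hcl : IsClosed {x | F x ≤ u} := isClosed_le hc continuous_const
  have hne : {x | F x ≤ u}.Nonempty := by
    obtain ⟨x, hx⟩ := (h0.eventually (gt_mem_nhds hu.1)).exists
    exact ⟨x, hx.le⟩
  have hbd : BddAbove {x | F x ≤ u} := by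
    obtain ⟨y, hy⟩ := (h1.eventually (lt_mem_nhds hu.2)).exists
    refine ⟨y, fun x hx => ?_⟩
    by_contra hlt
    have := hm (not_le.mp hlt).le
    have hx' : F x ≤ u := hx
    linarith
  refine ⟨sSup {x | F x ≤ u}, fun x => ⟨fun hx => le_csSup hbd hx, fun hx => ?_⟩⟩
  exact (hm hx).trans (hcl.csSup_mem hne hbd)

/-- The weighted occupation measure. -/
noncomputable def occ (F : ℝ → ℝ) : Measure ℝ :=
  (volume.withDensity (fun x => ENNReal.ofReal (F x * (1 - F x)))).map F

lemma occ_finite (F : ℝ → ℝ) (hc : Continuous F)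
    (hi : Integrable (fun x => F x * (1 - F x))) : IsFiniteMeasure (occ F) := by
  have := isFiniteMeasure_withDensity_ofReal hi.2
  unfold occ
  infer_instance

lemma occ_ae (F : ℝ → ℝ) (hc : Continuous F) (hI : ∀ x, F x ∈ Icc (0:ℝ) 1) :
    ∀ᵐ u ∂(occ F), u ∈ Icc (0:ℝ) 1 := by
  unfold occ
  exact (ae_map_iff (p := fun u => u ∈ Icc (0:ℝ) 1) hc.aemeasurable measurableSet_Icc).2
    (ae_of_all _ hI)

lemma occ_integral (F : ℝ → ℝ) (hc : Continuous F) (hI : ∀ x, F x ∈ Icc (0:ℝ) 1)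
    (f : ℝ → ℝ) (hf : Continuous f) :
    ∫ u, f u ∂(occ F) = ∫ x, F x * (1 - F x) * f (F x) := by
  unfold occ
  rw [integral_map hc.aemeasurable hf.aestronglyMeasurable,
    integral_withDensity_eq_integral_toReal_smul (by fun_prop) (ae_of_all _ fun x => by simp)]
  refine integral_congr_ae (ae_of_all _ fun x => ?_)
  have := hI x
  simp only [smul_eq_mul]
  rw [ENNReal.toReal_ofReal (mul_nonneg this.1 (by linarith [this.2]))]

lemma occ_lintegral (F : ℝ → ℝ) (hc : Continuous F) (a b : ℝ) (ha : 0 < a) (hb : b < 1) :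
    ∫⁻ u, (Ioc a b).indicator (fun u => (ENNReal.ofReal (u * (1 - u)))⁻¹) u ∂(occ F)
      = volume (F ⁻¹' Ioc a b) := by
  have hmeas : Measurable ((Ioc a b).indicator (fun u : ℝ => (ENNReal.ofReal (u * (1 - u)))⁻¹)) :=
    Measurable.indicator (by fun_prop) measurableSet_Ioc
  unfold occ
  rw [lintegral_map hmeas hc.measurable,
    lintegral_withDensity_eq_lintegral_mul _ (by fun_prop)
      (g := fun x => (Ioc a b).indicator (fun u : ℝ => (ENNReal.ofReal (u * (1 - u)))⁻¹) (F x))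
      (hmeas.comp hc.measurable),
    ← lintegral_indicator_one (hc.measurable measurableSet_Ioc)]
  refine lintegral_congr fun x => ?_
  by_cases hx : F x ∈ Ioc a b
  · have hpos : 0 < F x * (1 - F x) := mul_pos (ha.trans hx.1) (by linarith [hx.2])
    have hx' : x ∈ F ⁻¹' Ioc a b := hx
    simp only [Pi.mul_apply, indicator_of_mem hx, indicator_of_mem hx', Pi.one_apply]
    exact ENNReal.mul_inv_cancel (by simpa using hpos) ENNReal.ofReal_ne_top
  · have hx' : x ∉ F ⁻¹' Ioc a b := hx
    simp [Pi.mul_apply, indicator_of_notMem hx, indicator_of_notMem hx']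

/-- Hausdorff moment uniqueness. -/
lemma ext_of_moments (μ ν : Measure ℝ) [IsFiniteMeasure μ] [IsFiniteMeasure ν]
    (hμ : ∀ᵐ u ∂μ, u ∈ Icc (0:ℝ) 1) (hν : ∀ᵐ u ∂ν, u ∈ Icc (0:ℝ) 1)
    (h : ∀ k : ℕ, ∫ u, u ^ k ∂μ = ∫ u, u ^ k ∂ν) : μ = ν := by
  have hpi : ∀ (ρ : Measure ℝ) [IsFiniteMeasure ρ], (∀ᵐ u ∂ρ, u ∈ Icc (0:ℝ) 1) →
      ∀ k : ℕ, Integrable (fun u : ℝ => u ^ k) ρ := by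
    intro ρ _ hρ k
    refine (integrable_const (1:ℝ)).mono' (by fun_prop) ?_
    filter_upwards [hρ] with u hu
    rw [Real.norm_of_nonneg (pow_nonneg hu.1 _)]
    exact pow_le_one₀ hu.1 hu.2
  have hpoly : ∀ (ρ : Measure ℝ) [IsFiniteMeasure ρ], (∀ᵐ u ∂ρ, u ∈ Icc (0:ℝ) 1) →
      ∀ p : Polynomial ℝ, Integrable (fun u : ℝ => p.eval u) ρ := by
    intro ρ _ hρ p
    simp_rw [Polynomial.eval_eq_sum_range]
    exact integrable_finsetSum _ fun i _ => (hpi ρ hρ i).const_mul _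
  have hpe : ∀ p : Polynomial ℝ, ∫ u, p.eval u ∂μ = ∫ u, p.eval u ∂ν := by
    intro p
    simp_rw [Polynomial.eval_eq_sum_range]
    rw [integral_finsetSum _ fun i _ => (hpi μ hμ i).const_mul _,
      integral_finsetSum _ fun i _ => (hpi ν hν i).const_mul _]
    simp_rw [integral_const_mul, h]
  have hclose : ∀ (ρ : Measure ℝ) [IsFiniteMeasure ρ], (∀ᵐ u ∂ρ, u ∈ Icc (0:ℝ) 1) →
      ∀ (f : BoundedContinuousFunction ℝ ℝ) (p : Polynomial ℝ) (ε : ℝ),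
      (∀ x ∈ Icc (0:ℝ) 1, |p.eval x - f x| < ε) →
      |∫ u, p.eval u ∂ρ - ∫ u, f u ∂ρ| ≤ ε * ρ.real univ := by
    intro ρ _ hρ f p ε hp
    rw [← integral_sub (hpoly ρ hρ p) (f.integrable ρ)]
    refine norm_integral_le_of_norm_le_const (f := fun u => p.eval u - f u) ?_
    filter_upwards [hρ] with u hu
    exact (hp u hu).le
  apply ext_of_forall_integral_eq_of_IsFiniteMeasure
  intro f
  set C := μ.real univ + ν.real univ + 1 with hC
  have hCμ : 0 ≤ μ.real univ := measureReal_nonneg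
  have hCν : 0 ≤ ν.real univ := measureReal_nonneg
  have hCpos : 0 < C := by positivity
  rw [← sub_eq_zero, ← abs_eq_zero]
  refine le_antisymm (le_of_forall_pos_le_add fun ε hε => ?_) (abs_nonneg _)
  obtain ⟨p, hp⟩ := exists_polynomial_near_of_continuousOn 0 1 f f.continuous.continuousOn
    (ε / C) (by positivity)
  have e1 := hclose μ hμ f p _ hp
  have e2 := hclose ν hν f p _ hp
  rw [hpe p] at e1
  have e3 : ε / C * μ.real univ + ε / C * ν.real univ ≤ ε := by
    have : ε / C * C = ε := by field_simp
    have : 0 < ε / C := by positivity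
    nlinarith
  rw [abs_le] at e1 e2 ⊢
  constructor <;> linarith [e1.1, e1.2, e2.1, e2.2]

/-- The weighted power moments from the cumulative entropies. -/
lemma moment_eq (F : ℝ → ℝ) (hc : Continuous F) (hI : ∀ x, F x ∈ Icc (0:ℝ) 1)
    (hi : Integrable (fun x => F x * (1 - F x))) (k : ℕ) :
    ∫ x, F x * (1 - F x) * F x ^ k
      = (∫ x, F x * (1 - F x ^ (k + 1))) - ∫ x, F x * (1 - F x ^ k) := by
  have hint : ∀ n : ℕ, Integrable (fun x => F x * (1 - F x ^ n)) := by
    intro n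
    refine (hi.const_mul (n:ℝ)).mono' (by fun_prop) (ae_of_all _ fun x => ?_)
    have hx := hI x
    have h1 : F x ^ n ≤ 1 := pow_le_one₀ hx.1 hx.2
    rw [Real.norm_of_nonneg (mul_nonneg hx.1 (by linarith))]
    have h2 := one_add_mul_le_pow (a := F x - 1) (by linarith [hx.1]) n
    have h3 : 1 - F x ^ n ≤ n * (1 - F x) := by
      rw [add_sub_cancel] at h2
      linarith
    nlinarith [mul_le_mul_of_nonneg_left h3 hx.1]
  rw [← integral_sub (hint _) (hint _)]
  refine integral_congr_ae (ae_of_all _ fun x => ?_)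
  simp only
  ring

lemma core (F G : ℝ → ℝ) (hFc : Continuous F) (hGc : Continuous G)
    (hFI : ∀ x, F x ∈ Icc (0:ℝ) 1) (hGI : ∀ x, G x ∈ Icc (0:ℝ) 1)
    (hFm : Monotone F) (hGm : Monotone G)
    (hF0 : Tendsto F atBot (𝓝 0)) (hF1 : Tendsto F atTop (𝓝 1))
    (hG0 : Tendsto G atBot (𝓝 0)) (hG1 : Tendsto G atTop (𝓝 1))
    (hFi : Integrable (fun x => F x * (1 - F x))) (hGi : Integrable (fun x => G x * (1 - G x)))
    (heq : ∀ n : ℕ, ∫ x : ℝ, F x * (1 - F x ^ n) = ∫ x : ℝ, G x * (1 - G x ^ n)) :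
    ∃ c : ℝ, ∀ x, G (x + c) = F x := by
  have := occ_finite F hFc hFi
  have := occ_finite G hGc hGi
  have hocc : occ F = occ G := by
    refine ext_of_moments _ _ (occ_ae F hFc hFI) (occ_ae G hGc hGI) fun k => ?_
    rw [occ_integral F hFc hFI _ (by fun_prop), occ_integral G hGc hGI _ (by fun_prop),
      moment_eq F hFc hFI hFi, moment_eq G hGc hGI hGi, heq, heq]
  have hvol : ∀ a b, 0 < a → b < 1 → volume (F ⁻¹' Ioc a b) = volume (G ⁻¹' Ioc a b) := by
    intro a b ha hb
    rw [← occ_lintegral F hFc a b ha hb, ← occ_lintegral G hGc a b ha hb, hocc]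
  choose! p hp using exists_quantile F hFm hFc hF0 hF1
  choose! q hq using exists_quantile G hGm hGc hG0 hG1
  have key : ∀ (H r : ℝ → ℝ), Continuous H → (∀ u ∈ Ioo (0:ℝ) 1, ∀ x, H x ≤ u ↔ x ≤ r u) →
      ∀ a ∈ Ioo (0:ℝ) 1, ∀ b ∈ Ioo (0:ℝ) 1, a ≤ b →
      r a ≤ r b ∧ volume (H ⁻¹' Ioc a b) = ENNReal.ofReal (r b - r a) := by
    intro H r hHc hr a ha b hb hab
    constructor
    · exact (hr b hb _).1 (((hr a ha _).2 le_rfl).trans hab)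
    · rw [← Real.volume_Ioc]
      congr 1
      ext x
      simp only [mem_preimage, mem_Ioc, hr b hb x, ← not_le, hr a ha x]
  have hdiff : ∀ a ∈ Ioo (0:ℝ) 1, ∀ b ∈ Ioo (0:ℝ) 1, a ≤ b → p b - p a = q b - q a := by
    intro a ha b hb hab
    obtain ⟨l1, v1⟩ := key F p hFc hp a ha b hb hab
    obtain ⟨l2, v2⟩ := key G q hGc hq a ha b hb hab
    have := hvol a b ha.1 hb.2
    rw [v1, v2, ENNReal.ofReal_eq_ofReal_iff (by linarith) (by linarith)] at this
    exact this
  have hhalf : (1/2 : ℝ) ∈ Ioo (0:ℝ) 1 := by constructor <;> norm_num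
  refine ⟨q (1/2) - p (1/2), fun x => ?_⟩
  set c := q (1/2) - p (1/2) with hcdef
  have hpq : ∀ u ∈ Ioo (0:ℝ) 1, q u = p u + c := by
    intro u hu
    rcases le_total u (1/2) with h | h
    · have := hdiff u hu _ hhalf h
      linarith
    · have := hdiff _ hhalf u hu h
      linarith
  have hiff : ∀ u ∈ Ioo (0:ℝ) 1, (G (x + c) ≤ u ↔ F x ≤ u) := by
    intro u hu
    rw [hq u hu, hp u hu, hpq u hu, add_le_add_iff_right]
  have hFx := hFI x
  have hGx := hGI (x + c)
  rcases lt_trichotomy (G (x + c)) (F x) with h | h | h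
  · obtain ⟨u, hu1, hu2⟩ := exists_between h
    have := (hiff u ⟨by linarith [hGx.1], by linarith [hFx.2]⟩).1 hu1.le
    linarith
  · exact h
  · obtain ⟨u, hu1, hu2⟩ := exists_between h
    have := (hiff u ⟨by linarith [hFx.1], by linarith [hGx.2]⟩).2 hu1.le
    linarith

lemma cdf_facts {Ω : Type*} [MeasurableSpace Ω] (P : Measure Ω) [IsProbabilityMeasure P]
    (X : Ω → ℝ) (hXm : Measurable X) (F : ℝ → ℝ)
    (hF : ∀ x, F x = (P {ω | X ω ≤ x}).toReal) :
    F = cdf (P.map X) := by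
  have := Measure.isProbabilityMeasure_map (μ := P) hXm.aemeasurable
  ext x
  rw [cdf_eq_real, measureReal_def, Measure.map_apply hXm measurableSet_Iic, hF]
  rfl

end TsallisAux

/-- If two integrable real random variables with continuous cdfs have the
same cumulative Tsallis entropies `Δ_n` for every integer `n ≥ 1`, then they have the same
law up to translation. -/
theorem cumulative_tsallis_entropies_determine_law
    {Ω : Type*} [MeasureSpace Ω] [IsProbabilityMeasure (volume : Measure Ω)]
    {Ω' : Type*} [MeasureSpace Ω'] [IsProbabilityMeasure (volume : Measure Ω')]
    (X : Ω → ℝ) (hXm : Measurable X) (hXint : Integrable X)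
    (Y : Ω' → ℝ) (hYm : Measurable Y) (hYint : Integrable Y)
    (F G : ℝ → ℝ)
    (hF : ∀ x, F x = ((volume : Measure Ω) {ω | X ω ≤ x}).toReal)
    (hG : ∀ x, G x = ((volume : Measure Ω') {ω | Y ω ≤ x}).toReal)
    (hFcont : Continuous F) (hGcont : Continuous G)
    (heq : ∀ n : ℕ, 1 ≤ n →
      (1 / (n : ℝ)) * ∫ x : ℝ, F x * (1 - F x ^ n)
        = (1 / (n : ℝ)) * ∫ x : ℝ, G x * (1 - G x ^ n)) :
    ∃ c : ℝ, Measure.map Y (volume : Measure Ω')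
      = Measure.map (fun ω => X ω + c) (volume : Measure Ω) := by
  have := Measure.isProbabilityMeasure_map (μ := (volume : Measure Ω)) hXm.aemeasurable
  have := Measure.isProbabilityMeasure_map (μ := (volume : Measure Ω')) hYm.aemeasurable
  have hFi := TsallisAux.integrable_weight _ X hXm hXint F hF hFcont
  have hGi := TsallisAux.integrable_weight _ Y hYm hYint G hG hGcont
  have hFe := TsallisAux.cdf_facts _ X hXm F hF
  have hGe := TsallisAux.cdf_facts _ Y hYm G hG
  obtain ⟨c, hc⟩ := TsallisAux.core F G hFcont hGcont
    (fun x => by rw [hFe]; exact ⟨ProbabilityTheory.cdf_nonneg _ x, ProbabilityTheory.cdf_le_one _ x⟩)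
    (fun x => by rw [hGe]; exact ⟨ProbabilityTheory.cdf_nonneg _ x, ProbabilityTheory.cdf_le_one _ x⟩)
    (by rw [hFe]; exact ProbabilityTheory.monotone_cdf _)
    (by rw [hGe]; exact ProbabilityTheory.monotone_cdf _)
    (by rw [hFe]; exact ProbabilityTheory.tendsto_cdf_atBot _)
    (by rw [hFe]; exact ProbabilityTheory.tendsto_cdf_atTop _)
    (by rw [hGe]; exact ProbabilityTheory.tendsto_cdf_atBot _)
    (by rw [hGe]; exact ProbabilityTheory.tendsto_cdf_atTop _)
    hFi hGi (by
      intro n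
      rcases Nat.eq_zero_or_pos n with rfl | hn
      · simp
      · have hn' : (1 / (n : ℝ)) ≠ 0 := by positivity
        exact mul_left_cancel₀ hn' (heq n hn))
  refine ⟨c, ?_⟩
  have hXc : Measurable (fun ω => X ω + c) := hXm.add_const c
  have := Measure.isProbabilityMeasure_map (μ := (volume : Measure Ω)) hXc.aemeasurable
  refine Measure.ext_of_Iic _ _ fun z => ?_
  rw [Measure.map_apply hYm measurableSet_Iic, Measure.map_apply hXc measurableSet_Iic]
  have h1 := hc (z - c)
  rw [sub_add_cancel, hF, hG, ENNReal.toReal_eq_toReal_iff' (measure_ne_top _ _)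
    (measure_ne_top _ _)] at h1
  have h2 : (fun ω => X ω + c) ⁻¹' Iic z = {ω | X ω ≤ z - c} := by
    ext ω
    simp [le_sub_iff_add_le]
  rw [h2, ← h1]
  rfl
end

section
/- Let X be a real random variable with finite expectation and continuous cumulative distribution function F such that Δ_0(X) = −∫_ℝ F(x) log F(x) dx < ∞. Then for every s > −1 the series below converges and ∇_s(X) = (1+s) Σ_{n≥0} ((−s)_n / (n+1)!) Δ_n(X), where Δ_0(X) = −∫_ℝ F log F and Δ_n(X) = (1/n) ∫_ℝ F(x)(1 − F(x)^n) dx for n ≥ 1. -/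
open MeasureTheory Set

lemma aux_coef_succ (s : ℝ) (n : ℕ) :
    (ascPochhammer ℝ (n+1)).eval (-s) / (Nat.factorial (n + 1 + 1) : ℝ) * (n + 2)
      = (n - s) * ((ascPochhammer ℝ n).eval (-s) / (Nat.factorial (n + 1) : ℝ)) := by
  rw [ascPochhammer_succ_eval, Nat.factorial_succ (n+1)]
  have h : (Nat.factorial (n+1) : ℝ) ≠ 0 := by positivity
  push_cast
  field_simp
  ring

lemma aux_coef_summable (s : ℝ) (hs : -1 < s) :
    Summable (fun n : ℕ => |(ascPochhammer ℝ n).eval (-s) / (Nat.factorial (n + 1) : ℝ)|) := by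
  set a : ℕ → ℝ := fun n => (ascPochhammer ℝ n).eval (-s) / (Nat.factorial (n + 1) : ℝ) with ha
  obtain ⟨N, hN⟩ := exists_nat_ge s
  rw [← summable_nat_add_iff N]
  have key : ∀ n : ℕ, (1 + s) * |a (n + N)|
      = (n + N + 1) * |a (n + N)| - (n + 1 + N + 1) * |a (n + 1 + N)| := by
    intro n
    have h := congrArg abs (aux_coef_succ s (n + N))
    have p1 : (0:ℝ) ≤ ((n + N : ℕ) : ℝ) + 2 := by positivity
    have p2 : (0:ℝ) ≤ ((n + N : ℕ) : ℝ) - s := by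
      push_cast; linarith [(Nat.cast_nonneg n : (0:ℝ) ≤ n)]
    rw [abs_mul, abs_mul, abs_of_nonneg p1, abs_of_nonneg p2] at h
    have e : n + 1 + N = n + N + 1 := by ring
    rw [e]
    change |a (n + N + 1)| * _ = _ * |a (n + N)| at h
    push_cast at h
    linarith
  have : Summable (fun n : ℕ => (1 + s) * |a (n + N)|) := by
    refine summable_of_sum_range_le (c := (N + 1) * |a N|) ?_ ?_
    · intro n; exact mul_nonneg (by linarith) (abs_nonneg _)
    · intro n
      have : ∑ i ∈ Finset.range n, (1 + s) * |a (i + N)|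
          = (N + 1) * |a N| - (n + N + 1) * |a (n + N)| := by
        induction n with
        | zero => simp
        | succ n ih => rw [Finset.sum_range_succ, ih, key]; push_cast; ring
      rw [this]
      have : 0 ≤ (n + N + 1) * |a (n + N)| := by positivity
      linarith
  exact (summable_mul_left_iff (by linarith : (1 + s) ≠ 0)).1 this

lemma aux_series (s u : ℝ) (h0 : 0 < u) (h1 : u < 1) :
    HasSum (fun n : ℕ => (1 + s) * (((ascPochhammer ℝ n).eval (-s) / (Nat.factorial (n + 1) : ℝ)) * u ^ n))
      ((1 - (1 - u) ^ (s + 1)) / u) := by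
  have h := (Real.one_add_rpow_hasFPowerSeriesOnBall_zero (a := s + 1)).hasSum (y := -u)
    (by simp [enorm_eq_nnnorm, ← NNReal.coe_lt_one, abs_of_pos h0, h1])
  have hc : ∀ n : ℕ, Ring.choose (s + 1) n * (-u) ^ n
      = (ascPochhammer ℝ n).eval (-(s+1)) / (Nat.factorial n : ℝ) * u ^ n := by
    intro n
    have h2 := Ring.choose_neg' (-(s+1)) n
    rw [neg_neg] at h2
    have h3 := Ring.factorial_nsmul_multichoose_eq_ascPochhammer (-(s+1)) n
    rw [Polynomial.ascPochhammer_smeval_eq_eval] at h3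
    rw [← h3, h2, nsmul_eq_mul, neg_pow u]
    have h : (Nat.factorial n : ℝ) ≠ 0 := by positivity
    have hu : ((Int.negOnePow n • Ring.multichoose (-(s+1)) n : ℝ)) = (-1)^n * Ring.multichoose (-(s+1)) n := by
      simp [Units.smul_def, Int.negOnePow_def]
    rw [hu]
    have : ((-1:ℝ)^n) * (-1)^n = 1 := by rw [← mul_pow]; simp
    field_simp
    linear_combination (Ring.multichoose (-(s+1)) n) * this
  simp only [binomialSeries_apply, List.ofFn_const, List.prod_replicate, smul_eq_mul, hc, zero_add] at h
  rw [← hasSum_nat_add_iff' 1] at h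
  have h' := (h.mul_left (-1)).div_const u
  have e1 : (fun n : ℕ => (1 + s) * (((ascPochhammer ℝ n).eval (-s) / (Nat.factorial (n + 1) : ℝ)) * u ^ n))
      = (fun i : ℕ => -1 * (Polynomial.eval (-(s + 1)) (ascPochhammer ℝ (i + 1)) / ((i + 1).factorial : ℝ) * u ^ (i + 1)) / u) := by
    funext n
    rw [ascPochhammer_succ_left]
    simp only [Polynomial.eval_mul, Polynomial.eval_X, Polynomial.eval_comp, Polynomial.eval_add, Polynomial.eval_one]
    have : -(s+1)+1 = -s := by ring
    rw [this]
    field_simp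
    ring
  rw [e1]
  have e2 : (1 - (1 - u) ^ (s + 1)) / u = -1 * ((1 + -u) ^ (s + 1) -
          ∑ i ∈ Finset.range 1, Polynomial.eval (-(s + 1)) (ascPochhammer ℝ i) / (i.factorial : ℝ) * u ^ i) / u := by
    simp [sub_eq_add_neg, add_comm]
  rw [e2]
  exact h'

lemma aux_uniform {Ω : Type*} [MeasurableSpace Ω] (μ : Measure Ω) [IsProbabilityMeasure μ]
    (X : Ω → ℝ) (hXm : Measurable X)
    (F : ℝ → ℝ) (hF : ∀ x, F x = (μ {ω | X ω ≤ x}).toReal)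
    (hFcont : Continuous F) (hmono : Monotone F) (hb : ∀ x, 0 ≤ F x ∧ F x ≤ 1)
    (hbot : Filter.Tendsto F Filter.atBot (nhds 0)) (htop : Filter.Tendsto F Filter.atTop (nhds 1)) :
    μ.map (fun ω => F (X ω)) = (volume : Measure ℝ).restrict (Icc 0 1) := by
  have hm : Measurable (fun ω => F (X ω)) := hFcont.measurable.comp hXm
  have : IsProbabilityMeasure (μ.map (fun ω => F (X ω))) := Measure.isProbabilityMeasure_map hm.aemeasurable
  refine Measure.ext_of_Iic _ _ fun u => ?_
  rw [Measure.map_apply hm measurableSet_Iic, Measure.restrict_apply measurableSet_Iic]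
  rcases lt_or_ge u 0 with hu | hu
  · have e1 : (fun ω => F (X ω)) ⁻¹' Iic u = ∅ := by
      ext ω; simp; linarith [(hb (X ω)).1]
    have e2 : Iic u ∩ Icc 0 1 = ∅ := by
      ext x; simp; intros; linarith
    simp [e1, e2]
  rcases le_or_gt 1 u with hu1 | hu1
  · have e1 : (fun ω => F (X ω)) ⁻¹' Iic u = univ := by
      ext ω; simp; linarith [(hb (X ω)).2]
    have e2 : Iic u ∩ Icc 0 1 = Icc 0 1 := by
      ext x; simp; intros; linarith
    simp [e1, e2]
  have e2 : Iic u ∩ Icc 0 1 = Icc 0 u := by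
    ext x; simp; constructor
    · rintro ⟨a, b, c⟩; exact ⟨b, a⟩
    · rintro ⟨a, b⟩; exact ⟨b, a, by linarith⟩
  rw [e2, Real.volume_Icc, sub_zero]
  have hcl : IsClosed {x | F x ≤ u} := isClosed_le hFcont continuous_const
  have hbd : BddAbove {x | F x ≤ u} := by
    obtain ⟨T, hT⟩ := (htop.eventually (lt_mem_nhds hu1)).exists
    refine ⟨T, fun x hx => ?_⟩
    by_contra hxT
    have := hmono (not_le.1 hxT).le
    simp at hx
    linarith
  rcases eq_empty_or_nonempty {x | F x ≤ u} with he | hne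
  · have hu0 : u = 0 := by
      refine le_antisymm ?_ hu
      refine ge_of_tendsto' hbot fun x => ?_
      by_contra hx
      have : x ∈ {x | F x ≤ u} := (not_le.1 hx).le
      simp [he] at this
    have e1 : (fun ω => F (X ω)) ⁻¹' Iic u = ∅ := by
      ext ω
      have : X ω ∉ {x | F x ≤ u} := by simp [he]
      simpa using this
    rw [e1, hu0]; simp
  · set m := sSup {x | F x ≤ u} with hmdef
    have hmem : F m ≤ u := hcl.csSup_mem hne hbd
    have hgt : ∀ x, m < x → u < F x := by
      intro x hx
      by_contra h
      exact absurd (le_csSup hbd (not_lt.1 h : F x ≤ u)) (not_le.2 hx)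
    have hge : u ≤ F m := by
      have : Filter.Tendsto F (nhdsWithin m (Ioi m)) (nhds (F m)) :=
        hFcont.continuousAt.tendsto.mono_left nhdsWithin_le_nhds
      exact ge_of_tendsto this (Filter.eventually_of_mem self_mem_nhdsWithin fun x hx => (hgt x hx).le)
    have e1 : (fun ω => F (X ω)) ⁻¹' Iic u = {ω | X ω ≤ m} := by
      ext ω
      simp only [mem_preimage, mem_Iic, mem_ofPred_eq]
      constructor
      · intro h; by_contra h'; exact absurd (hgt _ (not_le.1 h')) (not_lt.2 h)
      · intro h; exact (hmono h).trans hmem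
    rw [e1, ← le_antisymm hmem hge, hF m, ENNReal.ofReal_toReal (measure_ne_top _ _)]

/-- primitive -/
noncomputable def auxJ (n : ℕ) (u : ℝ) : ℝ := if n = 0 then -Real.log u else (1 - u ^ n) / n

lemma auxJ_integral (n : ℕ) (c : ℝ) (h0 : 0 < c) (h1 : c ≤ 1) :
    ∫⁻ u in Icc c 1, ENNReal.ofReal (u ^ n / u) = ENNReal.ofReal (auxJ n c) := by
  have hi : IntegrableOn (fun u : ℝ => u ^ n / u) (Icc c 1) := by
    apply ContinuousOn.integrableOn_Icc
    apply ContinuousOn.div (by fun_prop) (by fun_prop)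
    intro x hx; linarith [hx.1]
  rw [← ofReal_integral_eq_lintegral_ofReal hi]
  · congr 1
    rw [integral_Icc_eq_integral_Ioc, ← intervalIntegral.integral_of_le h1]
    unfold auxJ
    rcases n with _ | n
    · simp [integral_inv_of_pos h0 one_pos]
    · have : ∫ u in c..1, u ^ (n+1) / u = ∫ u in c..1, u ^ n := by
        apply intervalIntegral.integral_congr
        intro u hu
        rw [uIcc_of_le h1] at hu
        have : u ≠ 0 := by linarith [hu.1]
        simp only
        field_simp
        ring
      rw [this]; simp
  · filter_upwards [ae_restrict_mem measurableSet_Icc] with u hu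
    have : 0 < u := by linarith [hu.1]
    simp only [Pi.zero_apply]
    positivity

lemma auxJ_nonneg (n : ℕ) (u : ℝ) (h0 : 0 ≤ u) (h1 : u ≤ 1) : 0 ≤ auxJ n u := by
  unfold auxJ
  split_ifs
  · linarith [Real.log_nonpos h0 h1]
  · exact div_nonneg (by linarith [pow_le_one₀ (n := n) h0 h1]) (by positivity)

lemma auxJ_le (n : ℕ) (u : ℝ) (h0 : 0 < u)  : auxJ n u ≤ - Real.log u := by
  unfold auxJ
  split_ifs with h
  · exact le_rfl
  · have hn : (0:ℝ) < n := by positivity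
    rw [div_le_iff₀ hn]
    have := Real.log_le_sub_one_of_pos (pow_pos h0 n)
    rw [Real.log_pow] at this
    linarith

lemma aux_inner {Ω : Type*} [MeasurableSpace Ω] (μ : Measure Ω) 
    (X : Ω → ℝ) (hXm : Measurable X)
    (F : ℝ → ℝ) (hFcont : Continuous F) (hmono : Monotone F) (hb : ∀ x, 0 ≤ F x ∧ F x ≤ 1)
    (hunif : μ.map (fun ω => F (X ω)) = (volume : Measure ℝ).restrict (Icc 0 1))
    (n : ℕ) (x : ℝ) (hx : 0 < F x) :
    ∫⁻ ω, (Iic (X ω)).indicator (fun _ => ENNReal.ofReal (F (X ω) ^ n / F (X ω))) x ∂μ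
      = ENNReal.ofReal (auxJ n (F x)) := by
  have hm : Measurable (fun ω => F (X ω)) := hFcont.measurable.comp hXm
  have hnull : ∀ᵐ ω ∂μ, F (X ω) ≠ F x := by
    have : ∀ᵐ u ∂(μ.map (fun ω => F (X ω))), u ≠ F x := by
      rw [hunif]; exact ae_restrict_of_ae (Measure.ae_ne volume (F x))
    exact ae_of_ae_map hm.aemeasurable this
  have h1 : ∫⁻ ω, (Iic (X ω)).indicator (fun _ => ENNReal.ofReal (F (X ω) ^ n / F (X ω))) x ∂μ
      = ∫⁻ ω, (fun u => (Ici (F x)).indicator (fun u => ENNReal.ofReal (u ^ n / u)) u) (F (X ω)) ∂μ := by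
    apply lintegral_congr_ae
    filter_upwards [hnull] with ω hω
    by_cases h : x ≤ X ω
    · have := hmono h
      simp [indicator, h, this]
    · have h2 : ¬ F x ≤ F (X ω) := fun h3 => hω (le_antisymm (hmono (not_le.1 h).le) h3)
      simp [indicator, h, h2]
  have hmeas : Measurable (fun u : ℝ => (Ici (F x)).indicator (fun u => ENNReal.ofReal (u ^ n / u)) u) :=
    Measurable.indicator (by fun_prop) measurableSet_Ici
  rw [h1, ← lintegral_map hmeas hm, hunif, lintegral_indicator measurableSet_Ici,
    Measure.restrict_restrict measurableSet_Ici]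
  have : Ici (F x) ∩ Icc 0 1 = Icc (F x) 1 := by
    ext y; simp; intro h h'; linarith
  rw [this, auxJ_integral n _ hx (hb x).2]

lemma aux_integrableOn (F : ℝ → ℝ) (hFcont : Continuous F) (hb : ∀ x, 0 ≤ F x ∧ F x ≤ 1)
    (hbot : Filter.Tendsto F Filter.atBot (nhds 0))
    (hfin : Integrable (fun x : ℝ => F x * Real.log (F x)) (volume : Measure ℝ)) (t : ℝ) :
    IntegrableOn F (Iic t) := by
  obtain ⟨T, hT⟩ := Filter.eventually_atBot.1 (hbot.eventually (gt_mem_nhds (Real.exp_pos (-1))))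
  have h1 : IntegrableOn F (Iic T) := by
    refine Integrable.mono (hfin.integrableOn (s := Iic T)) hFcont.aestronglyMeasurable ?_
    filter_upwards [ae_restrict_mem measurableSet_Iic] with x hx
    rcases (hb x).1.eq_or_lt with h | h
    · simp [← h]
    · have hl : Real.log (F x) ≤ -1 := by
        rw [Real.log_le_iff_le_exp h]; exact (hT x hx).le
      rw [norm_mul, Real.norm_eq_abs, Real.norm_eq_abs, abs_of_nonpos (by linarith : Real.log (F x) ≤ 0)]
      exact le_mul_of_one_le_right (abs_nonneg _) (by linarith)
  refine (h1.union (hFcont.integrableOn_Icc (a := T) (b := t))).mono_set ?_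
  intro x hx
  rcases le_total x T with h | h
  · exact Or.inl h
  · exact Or.inr ⟨h, hx⟩

lemma aux_FJ_integrable (F : ℝ → ℝ) (hFcont : Continuous F) (hb : ∀ x, 0 ≤ F x ∧ F x ≤ 1)
    (hfin : Integrable (fun x : ℝ => F x * Real.log (F x)) (volume : Measure ℝ)) (n : ℕ) :
    Integrable (fun x : ℝ => F x * auxJ n (F x)) := by
  refine Integrable.mono hfin ?_ ?_
  · have : Measurable (auxJ n) := by
      unfold auxJ
      split_ifs
      · exact Real.measurable_log.neg
      · fun_prop
    exact (hFcont.measurable.mul (this.comp hFcont.measurable)).aestronglyMeasurable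
  · refine Filter.Eventually.of_forall fun x => ?_
    rcases (hb x).1.eq_or_lt with h | h
    · simp [← h]
    · have h1 := auxJ_le n _ h
      have h2 := auxJ_nonneg n _ (hb x).1 (hb x).2
      rw [norm_mul, norm_mul]
      refine mul_le_mul_of_nonneg_left ?_ (norm_nonneg _)
      rw [Real.norm_eq_abs, Real.norm_eq_abs, abs_of_nonneg h2,
        abs_of_nonpos (Real.log_nonpos (hb x).1 (hb x).2)]
      exact h1

lemma aux_moment {Ω : Type*} [MeasurableSpace Ω] (μ : Measure Ω) [IsProbabilityMeasure μ]
    (X : Ω → ℝ) (hXm : Measurable X)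
    (F : ℝ → ℝ) (hFcont : Continuous F) (hmono : Monotone F) (hb : ∀ x, 0 ≤ F x ∧ F x ≤ 1)
    (hbot : Filter.Tendsto F Filter.atBot (nhds 0))
    (hunif : μ.map (fun ω => F (X ω)) = (volume : Measure ℝ).restrict (Icc 0 1))
    (hfin : Integrable (fun x : ℝ => F x * Real.log (F x)) (volume : Measure ℝ)) (n : ℕ) :
    Integrable (fun ω => F (X ω) ^ n * ((∫ x in Iic (X ω), F x) / F (X ω))) μ ∧
    ∫ ω, F (X ω) ^ n * ((∫ x in Iic (X ω), F x) / F (X ω)) ∂μ = ∫ x, F x * auxJ n (F x) := by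
  have hI := aux_integrableOn F hFcont hb hbot hfin
  have hFX : Measurable (fun ω => F (X ω)) := hFcont.measurable.comp hXm
  have hGmono : Monotone (fun t => ∫ x in Iic t, F x) := by
    intro a b hab
    exact setIntegral_mono_set (hI b) (Filter.Eventually.of_forall fun x => (hb x).1)
      (Iic_subset_Iic.2 hab).eventuallyLE
  have hGm : Measurable (fun ω => ∫ x in Iic (X ω), F x) := hGmono.measurable.comp hXm
  have hG0 : ∀ t, 0 ≤ ∫ x in Iic t, F x := fun t => integral_nonneg fun x => (hb x).1
  have hmeas : Measurable (fun ω => F (X ω) ^ n * ((∫ x in Iic (X ω), F x) / F (X ω))) :=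
    (hFX.pow_const n).mul (hGm.div hFX)
  have hnn : ∀ ω, 0 ≤ F (X ω) ^ n * ((∫ x in Iic (X ω), F x) / F (X ω)) := fun ω =>
    mul_nonneg (pow_nonneg (hb _).1 n) (div_nonneg (hG0 _) (hb _).1)
  have hJI := aux_FJ_integrable F hFcont hb hfin n
  have hJnn : ∀ x, 0 ≤ F x * auxJ n (F x) := fun x =>
    mul_nonneg (hb x).1 (auxJ_nonneg n _ (hb x).1 (hb x).2)
  have key : ∫⁻ ω, ENNReal.ofReal (F (X ω) ^ n * ((∫ x in Iic (X ω), F x) / F (X ω))) ∂μ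
      = ENNReal.ofReal (∫ x, F x * auxJ n (F x)) := by
    have h1 : ∀ ω, ENNReal.ofReal (F (X ω) ^ n * ((∫ x in Iic (X ω), F x) / F (X ω)))
        = ∫⁻ x, (Iic (X ω)).indicator (fun _ => ENNReal.ofReal (F (X ω) ^ n / F (X ω))) x
            * ENNReal.ofReal (F x) := by
      intro ω
      have e : ∀ x, (Iic (X ω)).indicator (fun _ => ENNReal.ofReal (F (X ω) ^ n / F (X ω))) x
            * ENNReal.ofReal (F x) = (Iic (X ω)).indicator
              (fun x => ENNReal.ofReal (F (X ω) ^ n / F (X ω)) * ENNReal.ofReal (F x)) x := by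
        intro x
        by_cases h : x ≤ X ω <;> simp [indicator, h]
      simp_rw [e]
      rw [lintegral_indicator measurableSet_Iic,
        lintegral_const_mul _ (hFcont.measurable.ennreal_ofReal),
        ← ofReal_integral_eq_lintegral_ofReal (hI _) (Filter.Eventually.of_forall fun x => (hb x).1),
        ← ENNReal.ofReal_mul (div_nonneg (pow_nonneg (hb _).1 n) (hb _).1)]
      congr 1
      ring
    simp_rw [h1]
    rw [lintegral_lintegral_swap]
    · rw [ofReal_integral_eq_lintegral_ofReal hJI (Filter.Eventually.of_forall hJnn)]
      refine lintegral_congr fun x => ?_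
      rw [lintegral_mul_const' _ _ ENNReal.ofReal_ne_top]
      rcases (hb x).1.eq_or_lt with h | h
      · simp [← h]
      · rw [aux_inner μ X hXm F hFcont hmono hb hunif n x h, mul_comm,
          ENNReal.ofReal_mul (hb x).1]
    · apply Measurable.aemeasurable
      have e : (Function.uncurry fun ω x => (Iic (X ω)).indicator
            (fun _ => ENNReal.ofReal (F (X ω) ^ n / F (X ω))) x * ENNReal.ofReal (F x))
          = fun p : Ω × ℝ => {p : Ω × ℝ | p.2 ≤ X p.1}.indicator
            (fun p => ENNReal.ofReal (F (X p.1) ^ n / F (X p.1))) p * ENNReal.ofReal (F p.2) := by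
        funext p
        rfl
      rw [e]
      refine Measurable.mul (Measurable.indicator ?_ ?_) ?_
      · exact (((hFX.pow_const n).div hFX).comp measurable_fst).ennreal_ofReal
      · exact measurableSet_le measurable_snd (hXm.comp measurable_fst)
      · exact (hFcont.measurable.comp measurable_snd).ennreal_ofReal
  constructor
  · refine ⟨hmeas.aestronglyMeasurable, ?_⟩
    rw [hasFiniteIntegral_iff_ofReal (Filter.Eventually.of_forall hnn), key]
    exact ENNReal.ofReal_lt_top
  · rw [integral_eq_lintegral_of_nonneg_ae (Filter.Eventually.of_forall hnn) hmeas.aestronglyMeasurable,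
      key, ENNReal.toReal_ofReal (integral_nonneg hJnn)]

/-- **Theorem Negatif (a).** For an integrable real random variable `X` with
continuous cdf `F` and finite cumulative entropy `Δ_0(X)`, for every `s > −1` the dual
cumulative Tsallis entropy `∇_s(X) = E[w_s(F(X)) μ̄(X)]`, `w_s(x) = (1 − (1−x)^{s+1})/x`,
admits the convergent series representation
`∇_s(X) = (1+s) Σ_{n≥0} ((−s)_n/(n+1)!) Δ_n(X)`. -/
theorem dual_cumulative_tsallis_series_repr
    {Ω : Type*} [MeasureSpace Ω] [IsProbabilityMeasure (volume : Measure Ω)]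
    (X : Ω → ℝ) (hXm : Measurable X) (hXint : Integrable X)
    (F : ℝ → ℝ) (hF : ∀ x, F x = ((volume : Measure Ω) {ω | X ω ≤ x}).toReal)
    (hFcont : Continuous F)
    (mbar : ℝ → ℝ)
    (hmbar : ∀ t, mbar t = if 0 < F t then (∫ x in Iic t, F x) / F t else 0)
    (hfin : Integrable (fun x : ℝ => F x * Real.log (F x)) (volume : Measure ℝ))
    (Δ : ℕ → ℝ)
    (hΔ0 : Δ 0 = -∫ x : ℝ, F x * Real.log (F x))
    (hΔ : ∀ n : ℕ, 1 ≤ n → Δ n = (1 / (n : ℝ)) * ∫ x : ℝ, F x * (1 - F x ^ n))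
    (s : ℝ) (hs : -1 < s) :
    Summable (fun n : ℕ =>
        ((ascPochhammer ℝ n).eval (-s) / (Nat.factorial (n + 1) : ℝ)) * Δ n)
    ∧ (∫ ω, ((1 - (1 - F (X ω)) ^ (s + 1)) / F (X ω)) * mbar (X ω) ∂(volume : Measure Ω))
        = (1 + s) * ∑' n : ℕ,
            ((ascPochhammer ℝ n).eval (-s) / (Nat.factorial (n + 1) : ℝ)) * Δ n := by
  have : IsProbabilityMeasure ((volume : Measure Ω).map X) :=
    Measure.isProbabilityMeasure_map hXm.aemeasurable
  have hcdf : F = ProbabilityTheory.cdf ((volume : Measure Ω).map X) := by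
    funext x
    rw [hF x, ProbabilityTheory.cdf_eq_real, measureReal_def, Measure.map_apply hXm measurableSet_Iic]
    rfl
  have hmono : Monotone F := hcdf ▸ ProbabilityTheory.monotone_cdf _
  have hb : ∀ x, 0 ≤ F x ∧ F x ≤ 1 := fun x => by
    rw [hcdf]; exact ⟨ProbabilityTheory.cdf_nonneg _ x, ProbabilityTheory.cdf_le_one _ x⟩
  have hbot : Filter.Tendsto F Filter.atBot (nhds 0) := hcdf ▸ ProbabilityTheory.tendsto_cdf_atBot _
  have htop : Filter.Tendsto F Filter.atTop (nhds 1) := hcdf ▸ ProbabilityTheory.tendsto_cdf_atTop _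
  have hunif := aux_uniform volume X hXm F hF hFcont hmono hb hbot htop
  have hFX : Measurable (fun ω => F (X ω)) := hFcont.measurable.comp hXm
  have hmom := aux_moment volume X hXm F hFcont hmono hb hbot hunif hfin
  have hΔJ : ∀ n, Δ n = ∫ x, F x * auxJ n (F x) := by
    intro n
    rcases Nat.eq_zero_or_pos n with rfl | hn
    · rw [hΔ0, ← integral_neg]
      simp [auxJ]
    · rw [hΔ n hn, ← integral_const_mul]
      congr 1
      funext x
      simp only [auxJ, hn.ne', if_false]
      ring
  have hmb : ∀ t, mbar t = (∫ x in Iic t, F x) / F t := by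
    intro t
    rw [hmbar]
    split_ifs with h
    · rfl
    · have : F t = 0 := le_antisymm (not_lt.1 h) (hb t).1
      simp [this]
  simp_rw [← hmb, ← hΔJ] at hmom
  have hmb0 : ∀ t, 0 ≤ mbar t := fun t => by
    rw [hmb]; exact div_nonneg (integral_nonneg fun x => (hb x).1) (hb t).1
  have hΔnn : ∀ n, 0 ≤ Δ n := fun n => by
    rw [hΔJ]
    exact integral_nonneg fun x => mul_nonneg (hb x).1 (auxJ_nonneg n _ (hb x).1 (hb x).2)
  have hΔle : ∀ n, Δ n ≤ Δ 0 := fun n => by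
    rw [← (hmom n).2, ← (hmom 0).2]
    refine integral_mono (hmom n).1 (hmom 0).1 fun ω => ?_
    simp only [pow_zero]
    exact mul_le_mul_of_nonneg_right (pow_le_one₀ (hb _).1 (hb _).2) (hmb0 _)
  set a : ℕ → ℝ := fun n => (ascPochhammer ℝ n).eval (-s) / (Nat.factorial (n + 1) : ℝ) with ha
  have hasum : Summable (fun n => |a n|) := aux_coef_summable s hs
  have habs : Summable (fun n => |a n| * Δ n) :=
    Summable.of_nonneg_of_le (fun n => mul_nonneg (abs_nonneg _) (hΔnn n))
      (fun n => mul_le_mul_of_nonneg_left (hΔle n) (abs_nonneg _)) (hasum.mul_right (Δ 0))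
  have hS : Summable (fun n => a n * Δ n) := by
    refine Summable.of_norm (habs.congr fun n => ?_)
    rw [norm_mul, Real.norm_eq_abs, Real.norm_eq_abs, abs_of_nonneg (hΔnn n)]
  refine ⟨hS, ?_⟩
  have hsum := hasSum_integral_of_summable_integral_norm (μ := (volume : Measure Ω))
    (F := fun n ω => ((1 + s) * a n) * (F (X ω) ^ n * mbar (X ω)))
    (fun n => (hmom n).1.const_mul _) (by
      refine (habs.mul_left |1 + s|).congr fun n => ?_
      rw [← (hmom n).2, ← integral_const_mul, ← integral_const_mul]
      congr 1
      funext ω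
      rw [norm_mul, norm_mul, Real.norm_eq_abs, Real.norm_eq_abs, Real.norm_eq_abs,
        abs_of_nonneg (mul_nonneg (pow_nonneg (hb _).1 n) (hmb0 _))]
      ring)
  have hne : ∀ᵐ ω ∂(volume : Measure Ω), F (X ω) ≠ 0 ∧ F (X ω) ≠ 1 := by
    have : ∀ᵐ u ∂((volume : Measure Ω).map (fun ω => F (X ω))), u ≠ 0 ∧ u ≠ 1 := by
      rw [hunif]
      exact ae_restrict_of_ae ((Measure.ae_ne volume 0).and (Measure.ae_ne volume 1))
    exact ae_of_ae_map hFX.aemeasurable this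
  have e1 : (∫ ω, ((1 - (1 - F (X ω)) ^ (s + 1)) / F (X ω)) * mbar (X ω) ∂(volume : Measure Ω))
      = ∫ ω, ∑' n, ((1 + s) * a n) * (F (X ω) ^ n * mbar (X ω)) ∂(volume : Measure Ω) := by
    apply integral_congr_ae
    filter_upwards [hne] with ω hω
    have h := (aux_series s (F (X ω)) (lt_of_le_of_ne (hb _).1 hω.1.symm)
      (lt_of_le_of_ne (hb _).2 hω.2)).mul_right (mbar (X ω))
    rw [← h.tsum_eq]
    congr 1
    funext n
    simp only [ha]
    ring
  rw [e1, ← hsum.tsum_eq, ← tsum_mul_left]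
  congr 1
  funext n
  rw [integral_const_mul, (hmom n).2]
  ring
end

section
/- Let X and Y be real random variables with finite expectation and continuous cumulative distribution functions such that Δ_0(X) < ∞ and Δ_0(Y) < ∞. If ∇_n(X) = ∇_n(Y) for every integer n ≥ 0, then X and Y have the same law up to translation, i.e. there is a constant c ∈ ℝ with Y distributed as X + c. -/
open MeasureTheory Set
theorem cdf_facts (ν : Measure ℝ) [IsProbabilityMeasure ν] (F : ℝ → ℝ)
    (hF : ∀ x, F x = ν.real (Iic x)) :
    Monotone F ∧ (∀ x, 0 ≤ F x) ∧ (∀ x, F x ≤ 1) ∧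
    Filter.Tendsto F Filter.atBot (nhds 0) ∧ Filter.Tendsto F Filter.atTop (nhds 1) := by
  have h : F = ProbabilityTheory.cdf ν := by
    funext x; rw [hF, ProbabilityTheory.cdf_eq_real]
  subst h
  exact ⟨ProbabilityTheory.monotone_cdf ν, ProbabilityTheory.cdf_nonneg ν, ProbabilityTheory.cdf_le_one ν,
    ProbabilityTheory.tendsto_cdf_atBot ν, ProbabilityTheory.tendsto_cdf_atTop ν⟩

theorem quantile (ν : Measure ℝ) [IsProbabilityMeasure ν] (F : ℝ → ℝ)
    (hF : ∀ x, F x = ν.real (Iic x)) (hc : Continuous F) (u : ℝ) (h0 : 0 < u) (h1 : u < 1) :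
    ∃ q, (∀ x, F x ≤ u ↔ x ≤ q) ∧ F q = u := by
  obtain ⟨hm, hn, hl, hb, ht⟩ := cdf_facts ν F hF
  obtain ⟨a, ha⟩ := (hb.eventually (gt_mem_nhds h0)).exists
  obtain ⟨b, hb⟩ := (ht.eventually (lt_mem_nhds h1)).exists
  obtain ⟨x, hx⟩ := mem_range_of_exists_le_of_exists_ge hc ⟨a, ha.le⟩ ⟨b, hb.le⟩
  have hbd : BddAbove {x | F x ≤ u} := ⟨b, fun y hy => by
    by_contra h
    have := hm (not_le.1 h).le
    simp at hy; linarith⟩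
  have hcl : IsClosed {x | F x ≤ u} := isClosed_le hc continuous_const
  have hq := hcl.csSup_mem ⟨a, ha.le⟩ hbd
  refine ⟨sSup {x | F x ≤ u}, fun y => ⟨fun h => le_csSup hbd h, fun h => (hm h).trans hq⟩, ?_⟩
  refine le_antisymm hq ?_
  rw [← hx]
  refine hm (le_csSup (by rw [hx]; exact hbd) (by simp))

theorem map_uniform (ν : Measure ℝ) [IsProbabilityMeasure ν] (F : ℝ → ℝ)
    (hF : ∀ x, F x = ν.real (Iic x)) (hc : Continuous F) :
    ν.map F = volume.restrict (Icc (0:ℝ) 1) := by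
  obtain ⟨hm, hn, hl, hb, ht⟩ := cdf_facts ν F hF
  have : IsProbabilityMeasure (ν.map F) := Measure.isProbabilityMeasure_map hc.measurable.aemeasurable
  -- measure of Iic for u in (0,1)
  have key : ∀ u, 0 < u → u < 1 → ν (F ⁻¹' Iic u) = ENNReal.ofReal u := by
    intro u h0 h1
    obtain ⟨q, hq, hqu⟩ := quantile ν F hF hc u h0 h1
    have : F ⁻¹' Iic u = Iic q := by ext x; simp [hq]
    rw [this, ← hqu, hF]; simp
  refine Measure.ext_of_Iic _ _ fun u => ?_
  rw [Measure.map_apply hc.measurable measurableSet_Iic, Measure.restrict_apply measurableSet_Iic]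
  rcases lt_or_ge u 1 with h1 | h1
  · rcases lt_or_ge 0 u with h0 | h0
    · rw [key u h0 h1]
      have : Iic u ∩ Icc (0:ℝ) 1 = Icc 0 u := by
        ext x; simp; constructor
        · rintro ⟨a, b, c⟩; exact ⟨b, a⟩
        · rintro ⟨a, b⟩; exact ⟨b, a, by linarith⟩
      rw [this]; simp
    · have e1 : volume (Iic u ∩ Icc (0:ℝ) 1) = 0 := by
        refine measure_mono_null (t := {0}) ?_ (by simp)
        intro x; simp; intro a b c; linarith
      rw [e1]
      refine le_antisymm (le_of_forall_gt fun ε hε => ?_) (zero_le)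
      obtain ⟨δ, hδ0, hδ⟩ := ENNReal.lt_iff_exists_nnreal_btwn.1 hε
      have hδ0' : 0 < (δ : ℝ) := by exact_mod_cast hδ0
      have h2 : 0 < min (δ:ℝ) (1/2) := lt_min hδ0' (by norm_num)
      refine lt_of_le_of_lt ?_ hδ
      calc ν (F ⁻¹' Iic u) ≤ ν (F ⁻¹' Iic (min (δ:ℝ) (1/2))) := by
            refine measure_mono fun x hx => ?_
            simp only [mem_preimage, mem_Iic] at *; linarith
        _ = ENNReal.ofReal (min (δ:ℝ) (1/2)) := key _ h2 (lt_of_le_of_lt (min_le_right _ _) (by norm_num))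
        _ ≤ ENNReal.ofReal δ := ENNReal.ofReal_le_ofReal (min_le_left _ _)
        _ = δ := by simp
  · have e1 : F ⁻¹' Iic u = univ := by
      ext x; simp; exact (hl x).trans h1
    have e2 : Iic u ∩ Icc (0:ℝ) 1 = Icc 0 1 := by
      ext x; simp; intro _ _; linarith
    rw [e1, e2]; simp

/-- Tonelli. -/
theorem tonelli (ν : Measure ℝ) [IsProbabilityMeasure ν] (F : ℝ → ℝ)
    (hF : ∀ x, F x = ν.real (Iic x)) (hc : Continuous F) (g : ℝ → ENNReal) (hg : Measurable g) :
    ∫⁻ t, g (F t) * (∫⁻ x in Iic t, ENNReal.ofReal (F x)) ∂ν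
      = ∫⁻ x, ENNReal.ofReal (F x) * (∫⁻ v in Icc (F x) 1, g v) := by
  obtain ⟨hm, hn, hl, hb, ht⟩ := cdf_facts ν F hF
  have hFm := hc.measurable
  have hu := map_uniform ν F hF hc
  let K : ℝ → ℝ → ENNReal := fun t x => (Ici x).indicator (fun t => g (F t)) t * ENNReal.ofReal (F x)
  have hS : MeasurableSet {p : ℝ × ℝ | p.2 ≤ p.1} := measurableSet_le measurable_snd measurable_fst
  have hK : Measurable (Function.uncurry K) := by
    have : Function.uncurry K = ({p : ℝ × ℝ | p.2 ≤ p.1}).indicator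
        (fun p => g (F p.1) * ENNReal.ofReal (F p.2)) := by
      ext p; simp only [Function.uncurry, K, indicator]; simp
    rw [this]
    exact Measurable.indicator (by fun_prop) hS
  calc _ = ∫⁻ t, ∫⁻ x, K t x ∂volume ∂ν := by
        refine lintegral_congr fun t => ?_
        rw [← lintegral_indicator measurableSet_Iic, ← lintegral_const_mul _ (Measurable.indicator (by fun_prop) measurableSet_Iic)]
        refine lintegral_congr fun x => ?_
        simp only [K, indicator]; simp
    _ = ∫⁻ x, ∫⁻ t, K t x ∂ν := lintegral_lintegral_swap hK.aemeasurable
    _ = _ := by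
        refine lintegral_congr fun x => ?_
        simp only [K]
        rw [lintegral_mul_const _ (Measurable.indicator (by fun_prop) measurableSet_Ici), mul_comm]
        congr 1
        have h0 : ν (F ⁻¹' {F x}) = 0 := by
          rw [← Measure.map_apply hFm (measurableSet_singleton _), hu]; simp
        have : ∀ᵐ t ∂ν, (Ici x).indicator (fun t => g (F t)) t = (Ici (F x)).indicator g (F t) := by
          have : ∀ᵐ t ∂ν, F t ≠ F x := by
            rw [ae_iff]; simpa [preimage] using h0
          filter_upwards [this] with t htx
          have : x ≤ t ↔ F x ≤ F t := ⟨fun h => hm h, fun h => by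
            by_contra h'
            exact htx (le_antisymm (hm (not_le.1 h').le) h)⟩
          simp [indicator, this]
        rw [lintegral_congr_ae this, ← lintegral_map (f := (Ici (F x)).indicator g) (hg.indicator measurableSet_Ici) hFm, hu, lintegral_indicator measurableSet_Ici, Measure.restrict_restrict measurableSet_Ici]
        congr 2
        ext y; simp; intro h _; exact (hn x).trans h

theorem F_integrable_Iic (ν : Measure ℝ) [IsProbabilityMeasure ν] (F : ℝ → ℝ)
    (hF : ∀ x, F x = ν.real (Iic x)) (hc : Continuous F)
    (hfin : Integrable (fun x : ℝ => F x * Real.log (F x)) volume) (t : ℝ) :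
    IntegrableOn F (Iic t) volume := by
  obtain ⟨hm, hn, hl, hb, ht⟩ := cdf_facts ν F hF
  obtain ⟨a, ha⟩ := (hb.eventually (gt_mem_nhds (Real.exp_pos (-1)))).exists
  have h1 : IntegrableOn F (Iic a) volume := by
    refine Integrable.mono' hfin.norm.integrableOn hc.aestronglyMeasurable ?_
    refine (ae_restrict_iff' measurableSet_Iic).2 (Filter.Eventually.of_forall fun x hx => ?_)
    have hxa : F x < Real.exp (-1) := (hm hx).trans_lt ha
    rw [Real.norm_of_nonneg (hn x), norm_mul, Real.norm_of_nonneg (hn x)]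
    rcases (hn x).eq_or_lt with h | h
    · simp [← h]
    · have : Real.log (F x) < -1 := (Real.log_lt_iff_lt_exp h).2 hxa
      rw [Real.norm_eq_abs, abs_of_neg (by linarith)]
      nlinarith
  have h2 : IntegrableOn F (Icc a t) volume := hc.continuousOn.integrableOn_compact isCompact_Icc
  refine (h1.union h2).mono_set ?_
  intro x hx
  rcases le_total x a with h | h
  · exact Or.inl h
  · exact Or.inr ⟨h, hx⟩

theorem F_one_sub_integrable (ν : Measure ℝ) [IsProbabilityMeasure ν] (F : ℝ → ℝ)
    (hF : ∀ x, F x = ν.real (Iic x)) (hc : Continuous F)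
    (hfin : Integrable (fun x : ℝ => F x * Real.log (F x)) volume) :
    Integrable (fun x => F x * (1 - F x)) volume := by
  obtain ⟨hm, hn, hl, hb, ht⟩ := cdf_facts ν F hF
  refine Integrable.mono' hfin.norm (by fun_prop) (Filter.Eventually.of_forall fun x => ?_)
  have := hl x
  rw [Real.norm_of_nonneg (mul_nonneg (hn x) (by linarith)), norm_mul, Real.norm_of_nonneg (hn x)]
  rcases (hn x).eq_or_lt with h | h
  · simp [← h]
  · have := Real.log_le_sub_one_of_pos h
    rw [Real.norm_eq_abs, abs_of_nonpos (by linarith)]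
    nlinarith

theorem inner_log (a : ℝ) (h0 : 0 < a) (h1 : a ≤ 1) :
    ∫⁻ v in Icc a 1, ENNReal.ofReal (1 / v) = ENNReal.ofReal (- Real.log a) := by
  have hi : IntegrableOn (fun v : ℝ => 1 / v) (Icc a 1) := by
    refine ContinuousOn.integrableOn_compact isCompact_Icc (fun x hx => ?_)
    have : x ≠ 0 := (h0.trans_le hx.1).ne'
    exact (ContinuousAt.div₀ continuousAt_const continuousAt_id this).continuousWithinAt
  rw [← ofReal_integral_eq_lintegral_ofReal hi]
  · rw [integral_Icc_eq_integral_Ioc, ← intervalIntegral.integral_of_le h1,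
      integral_one_div_of_pos h0 one_pos]
    simp
  · refine (ae_restrict_iff' measurableSet_Icc).2 (Filter.Eventually.of_forall fun x hx => ?_)
    have := h0.trans_le hx.1
    simp; exact this.le

theorem inner_pow (a : ℝ) (h1 : a ≤ 1) (n : ℕ) :
    ∫⁻ v in Icc a 1, ENNReal.ofReal ((1 - v) ^ n)
      = ENNReal.ofReal ((1 - a) ^ (n + 1) / (n + 1)) := by
  have hi : IntegrableOn (fun v : ℝ => (1 - v) ^ n) (Icc a 1) :=
    ContinuousOn.integrableOn_compact isCompact_Icc (by fun_prop)
  rw [← ofReal_integral_eq_lintegral_ofReal hi]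
  · rw [integral_Icc_eq_integral_Ioc, ← intervalIntegral.integral_of_le h1,
      intervalIntegral.integral_comp_sub_left (fun x => x ^ n) 1]
    simp
  · refine (ae_restrict_iff' measurableSet_Icc).2 (Filter.Eventually.of_forall fun x hx => ?_)
    have := hx.2
    exact pow_nonneg (by linarith) _

theorem lemA (ν : Measure ℝ) [IsProbabilityMeasure ν] (F : ℝ → ℝ)
    (hF : ∀ x, F x = ν.real (Iic x)) (hc : Continuous F)
    (hfin : Integrable (fun x : ℝ => F x * Real.log (F x)) volume)
    (m : ℝ → ℝ) (hm : ∀ t, m t = if 0 < F t then (∫ x in Iic t, F x) / F t else 0) :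
    Integrable m ν ∧ ∀ n : ℕ, ∫ t, (1 - F t) ^ n * (F t * m t) ∂ν
      = (∫ x, (1 - F x) ^ n * (F x * (1 - F x))) / (n + 1) := by
  obtain ⟨hmono, hn, hl, hb, ht⟩ := cdf_facts ν F hF
  have hFm := hc.measurable
  have hIic := F_integrable_Iic ν F hF hc hfin
  set J : ℝ → ENNReal := fun t => ∫⁻ x in Iic t, ENNReal.ofReal (F x) with hJ
  have hJm : Measurable J := by
    refine Monotone.measurable fun s t hst => ?_
    exact lintegral_mono_set (Iic_subset_Iic.2 hst)
  have hJfin : ∀ t, ENNReal.ofReal (J t).toReal = J t := fun t =>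
    ENNReal.ofReal_toReal ((hIic t).lintegral_lt_top).ne
  have hJr : ∀ t, ∫ x in Iic t, F x = (J t).toReal := fun t => by
    rw [integral_eq_lintegral_of_nonneg_ae (Filter.Eventually.of_forall hn) hc.aestronglyMeasurable]
  have hm' : ∀ t, m t = (J t).toReal / F t := fun t => by
    rw [hm, hJr]
    split_ifs with h
    · rfl
    · have : F t = 0 := le_antisymm (not_lt.1 h) (hn t)
      simp [this]
  have hmm : Measurable m := by
    have : m = fun t => (J t).toReal / F t := funext hm'
    rw [this]; fun_prop
  have hm0 : ∀ t, 0 ≤ m t := fun t => by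
    rw [hm']; exact div_nonneg ENNReal.toReal_nonneg (hn t)
  have hFmul : ∀ t, F t * m t = (J t).toReal := fun t => by
    rw [hm']
    rcases (hn t).eq_or_lt with h | h
    · have : J t = 0 := by
        simp only [hJ]
        rw [lintegral_eq_zero_iff (by fun_prop)]
        refine (ae_restrict_iff' measurableSet_Iic).2 (Filter.Eventually.of_forall fun x hx => ?_)
        have := hmono hx
        simp; linarith
      simp [this]
    · field_simp
  refine ⟨⟨hmm.aestronglyMeasurable, ?_⟩, fun n => ?_⟩
  · rw [hasFiniteIntegral_iff_ofReal (Filter.Eventually.of_forall hm0)]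
    calc ∫⁻ t, ENNReal.ofReal (m t) ∂ν
        = ∫⁻ t, ENNReal.ofReal (1 / F t) * J t ∂ν := by
          refine lintegral_congr fun t => ?_
          rw [← hJfin, ← ENNReal.ofReal_mul (by have := hn t; positivity), hm']
          congr 1; ring
      _ = ∫⁻ x, ENNReal.ofReal (F x) * (∫⁻ v in Icc (F x) 1, ENNReal.ofReal (1 / v)) :=
          tonelli ν F hF hc (fun v => ENNReal.ofReal (1 / v)) (by fun_prop)
      _ = ∫⁻ x, ENNReal.ofReal (-(F x * Real.log (F x))) := by
          refine lintegral_congr fun x => ?_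
          rcases (hn x).eq_or_lt with h | h
          · simp [← h]
          · rw [inner_log _ h (hl x), ← ENNReal.ofReal_mul (hn x)]
            congr 1; ring
      _ < ⊤ := hfin.neg.lintegral_lt_top
  · have h1 : ∀ t, 0 ≤ 1 - F t := fun t => by have := hl t; linarith
    rw [integral_eq_lintegral_of_nonneg_ae
      (Filter.Eventually.of_forall fun t => mul_nonneg (pow_nonneg (h1 t) n) (mul_nonneg (hn t) (hm0 t)))
      (by fun_prop), ← integral_div, integral_eq_lintegral_of_nonneg_ae
      (Filter.Eventually.of_forall fun t => div_nonneg (mul_nonneg (pow_nonneg (h1 t) n) (mul_nonneg (hn t) (h1 t))) (by positivity)) (by fun_prop)]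
    congr 1
    calc _ = ∫⁻ t, ENNReal.ofReal ((1 - F t) ^ n) * J t ∂ν := by
          refine lintegral_congr fun t => ?_
          rw [hFmul, ENNReal.ofReal_mul (pow_nonneg (h1 t) n), hJfin]
      _ = _ := tonelli ν F hF hc (fun v => ENNReal.ofReal ((1 - v) ^ n)) (by fun_prop)
      _ = _ := by
          refine lintegral_congr fun x => ?_
          rw [inner_pow _ (hl x), ← ENNReal.ofReal_mul (hn x)]
          congr 1; ring

theorem lemA2 (ν : Measure ℝ) [IsProbabilityMeasure ν] (F : ℝ → ℝ)
    (hF : ∀ x, F x = ν.real (Iic x)) (hc : Continuous F)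
    (hfin : Integrable (fun x : ℝ => F x * Real.log (F x)) volume)
    (m : ℝ → ℝ) (hm : ∀ t, m t = if 0 < F t then (∫ x in Iic t, F x) / F t else 0) :
    ∃ b : ℕ → ℝ, (∀ n : ℕ, ∫ t, ((1 - (1 - F t) ^ (n + 1)) / F t) * m t ∂ν
        = ∑ k ∈ Finset.range (n + 1), b k) ∧
      ∀ n : ℕ, b n - b (n + 1) = (∫ x, (1 - F x) ^ n * (F x * (1 - F x))) / (n + 1) := by
  obtain ⟨hmono, hn, hl, hb, ht⟩ := cdf_facts ν F hF
  obtain ⟨hi, hA⟩ := lemA ν F hF hc hfin m hm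
  have hk : ∀ k : ℕ, Integrable (fun t => (1 - F t) ^ k * m t) ν := fun k => by
    refine hi.bdd_mul (c := 1) (by fun_prop) (Filter.Eventually.of_forall fun t => ?_)
    have h1 := hn t
    have h2 := hl t
    rw [Real.norm_of_nonneg (pow_nonneg (by linarith) _)]
    exact pow_le_one₀ (by linarith) (by linarith)
  refine ⟨fun k => ∫ t, (1 - F t) ^ k * m t ∂ν, fun n => ?_, fun n => ?_⟩
  · rw [← integral_finsetSum _ fun k _ => hk k]
    refine integral_congr_ae (Filter.Eventually.of_forall fun t => ?_)
    rcases (hn t).eq_or_lt with h | h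
    · have : m t = 0 := by rw [hm]; simp [← h]
      simp [this]
    · simp only []
      rw [← Finset.sum_mul, geom_sum_eq (by linarith)]
      congr 1
      rw [div_eq_div_iff h.ne' (by linarith)]; ring
  · rw [← hA, ← integral_sub (hk n) (hk (n+1))]
    congr 1; ext t; ring

theorem moments_determine (μ ν : Measure ℝ) [IsFiniteMeasure μ] [IsFiniteMeasure ν]
    (hμ : ∀ᵐ x ∂μ, x ∈ Icc (0:ℝ) 1) (hν : ∀ᵐ x ∂ν, x ∈ Icc (0:ℝ) 1)
    (h : ∀ n : ℕ, ∫ x, x ^ n ∂μ = ∫ x, x ^ n ∂ν) : μ = ν := by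
  have hpow : ∀ (κ : Measure ℝ) [IsFiniteMeasure κ], (∀ᵐ x ∂κ, x ∈ Icc (0:ℝ) 1) → ∀ n : ℕ,
      Integrable (fun x => x ^ n) κ := by
    intro κ _ hκ n
    refine Integrable.of_bound (by fun_prop) 1 ?_
    filter_upwards [hκ] with x hx
    rw [Real.norm_of_nonneg (pow_nonneg hx.1 _)]
    exact pow_le_one₀ hx.1 hx.2
  have hpi : ∀ (κ : Measure ℝ) [IsFiniteMeasure κ], (∀ᵐ x ∂κ, x ∈ Icc (0:ℝ) 1) →
      ∀ p : Polynomial ℝ, Integrable (fun x => p.eval x) κ := by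
    intro κ _ hκ p
    simp only [Polynomial.eval_eq_sum_range]
    exact integrable_finsetSum _ fun i _ => (hpow κ hκ i).const_mul _
  have hp : ∀ p : Polynomial ℝ, ∫ x, p.eval x ∂μ = ∫ x, p.eval x ∂ν := by
    intro p
    simp only [Polynomial.eval_eq_sum_range]
    rw [integral_finsetSum _ fun i _ => (hpow μ hμ i).const_mul _,
      integral_finsetSum _ fun i _ => (hpow ν hν i).const_mul _]
    simp only [integral_const_mul, h]
  have hest : ∀ (κ : Measure ℝ) [IsFiniteMeasure κ], (∀ᵐ x ∂κ, x ∈ Icc (0:ℝ) 1) →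
      ∀ (f : BoundedContinuousFunction ℝ ℝ) (p : Polynomial ℝ) (ε : ℝ),
      (∀ x ∈ Icc (0:ℝ) 1, |p.eval x - f x| < ε) →
      |∫ x, p.eval x ∂κ - ∫ x, f x ∂κ| ≤ ε * κ.real univ := by
    intro κ _ hκ f p ε hpf
    rw [← integral_sub (hpi κ hκ p) (f.integrable κ)]
    refine norm_integral_le_of_norm_le_const (μ := κ) (f := fun x => p.eval x - f x) ?_
    filter_upwards [hκ] with x hx
    exact (hpf x hx).le
  refine ext_of_forall_integral_eq_of_IsFiniteMeasure fun f => ?_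
  refine eq_of_abs_sub_le_all fun ε hε => ?_
  have hM : 0 < μ.real univ + ν.real univ + 1 := by positivity
  obtain ⟨p, hpf⟩ := exists_polynomial_near_of_continuousOn 0 1 f f.continuous.continuousOn
    (ε / (μ.real univ + ν.real univ + 1)) (by positivity)
  have e1 := abs_le.1 (hest μ hμ f p _ hpf)
  have e2 := abs_le.1 (hest ν hν f p _ hpf)
  have e3 : ε / (μ.real univ + ν.real univ + 1) * (μ.real univ + ν.real univ + 1) = ε := by
    field_simp
  have e4 : 0 < ε / (μ.real univ + ν.real univ + 1) := by positivity
  rw [hp p] at e1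
  rw [abs_le]
  constructor <;> nlinarith [e1.1, e1.2, e2.1, e2.2]

/-- The image under `1 - F` of the measure `F (1 - F) dx`. -/
noncomputable def imgMeas (F : ℝ → ℝ) : Measure ℝ :=
  (volume.withDensity fun x => ENNReal.ofReal (F x * (1 - F x))).map (fun x => 1 - F x)

theorem imgMeas_slice (F : ℝ → ℝ) (hc : Continuous F) (h0 : ∀ x, 0 ≤ F x) (h1 : ∀ x, F x ≤ 1)
    (u v : ℝ) (hu : 0 < u) (hv : v < 1) :
    volume {x | u < F x ∧ F x ≤ v}
      = ∫⁻ y in Ico (1 - v) (1 - u), ENNReal.ofReal (1 / (y * (1 - y))) ∂(imgMeas F) := by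
  have hFm := hc.measurable
  have hgm : Measurable ((Ico (1 - v) (1 - u)).indicator
      (fun y : ℝ => ENNReal.ofReal (1 / (y * (1 - y))))) :=
    Measurable.indicator (by fun_prop) measurableSet_Ico
  have hm1 : Measurable (fun x => 1 - F x) := by fun_prop
  have hcomp : ∀ f : ℝ → ENNReal, ∫⁻ a, f (1 - F a) ∂(volume.withDensity
      fun x => ENNReal.ofReal (F x * (1 - F x)))
      = ∫⁻ a, (f ∘ fun x => 1 - F x) a ∂(volume.withDensity
      fun x => ENNReal.ofReal (F x * (1 - F x))) := fun f => rfl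
  rw [imgMeas, ← lintegral_indicator measurableSet_Ico, lintegral_map
    hgm hm1, hcomp,
    lintegral_withDensity_eq_lintegral_mul volume (by fun_prop) (hgm.comp hm1)]
  have hS : MeasurableSet {x | u < F x ∧ F x ≤ v} :=
    (measurableSet_lt measurable_const hFm).inter (measurableSet_le hFm measurable_const)
  rw [← lintegral_indicator_one hS]
  refine lintegral_congr fun x => ?_
  by_cases hx : u < F x ∧ F x ≤ v
  · have hx' : 1 - F x ∈ Ico (1 - v) (1 - u) := ⟨by linarith [hx.2], by linarith [hx.1]⟩
    have p1 : 0 < F x := by linarith [hx.1]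
    have p2 : 0 < 1 - F x := by linarith [hx.2]
    simp only [Pi.mul_apply, Function.comp, indicator_of_mem hx']
    rw [indicator_of_mem (show x ∈ {x | u < F x ∧ F x ≤ v} from hx), ← ENNReal.ofReal_mul (by positivity)]
    have : F x * (1 - F x) * (1 / ((1 - F x) * (1 - (1 - F x)))) = 1 := by
      rw [sub_sub_cancel]; field_simp
    rw [this]; simp
  · have hx' : 1 - F x ∉ Ico (1 - v) (1 - u) := fun h => hx ⟨by linarith [h.2], by linarith [h.1]⟩
    simp only [Pi.mul_apply, Function.comp, indicator_of_notMem hx']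
    rw [indicator_of_notMem (show x ∉ {x | u < F x ∧ F x ≤ v} from hx)]; simp

theorem imgMeas_moment (F : ℝ → ℝ) (hc : Continuous F) (h0 : ∀ x, 0 ≤ F x) (h1 : ∀ x, F x ≤ 1)
    (hi : Integrable (fun x => F x * (1 - F x)) volume) :
    IsFiniteMeasure (imgMeas F) ∧ (∀ᵐ y ∂(imgMeas F), y ∈ Icc (0:ℝ) 1) ∧
    ∀ n : ℕ, ∫ y, y ^ n ∂(imgMeas F) = ∫ x, (1 - F x) ^ n * (F x * (1 - F x)) := by
  have hFm := hc.measurable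
  refine ⟨?_, ?_, fun n => ?_⟩
  · have : IsFiniteMeasure (volume.withDensity fun x => ENNReal.ofReal (F x * (1 - F x))) :=
      isFiniteMeasure_withDensity hi.lintegral_lt_top.ne
    unfold imgMeas; infer_instance
  · unfold imgMeas
    refine (ae_map_iff (by fun_prop) (p := fun y => y ∈ Icc (0:ℝ) 1) measurableSet_Icc).2 ?_
    exact Filter.Eventually.of_forall fun x => ⟨by linarith [h1 x], by linarith [h0 x]⟩
  · unfold imgMeas
    rw [integral_map (by fun_prop) (by fun_prop), integral_withDensity_eq_integral_toReal_smul
      (by fun_prop) (by simp)]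
    congr 1; ext x
    rw [ENNReal.toReal_ofReal (mul_nonneg (h0 x) (by linarith [h1 x]))]
    simp [mul_comm]

theorem law_shift (μ ν : Measure ℝ) [IsProbabilityMeasure μ] [IsProbabilityMeasure ν] (F G : ℝ → ℝ)
    (hF : ∀ x, F x = μ.real (Iic x)) (hG : ∀ x, G x = ν.real (Iic x))
    (hFc : Continuous F) (hGc : Continuous G) (hImg : imgMeas F = imgMeas G) :
    ∃ c : ℝ, ∀ x, G (x + c) = F x := by
  obtain ⟨-, hF0, hF1, -, -⟩ := cdf_facts μ F hF
  obtain ⟨-, hG0, hG1, -, -⟩ := cdf_facts ν G hG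
  choose! p hp hp' using quantile μ F hF hFc
  choose! q hq hq' using quantile ν G hG hGc
  have key : ∀ u v, 0 < u → u < v → v < 1 → p v - p u = q v - q u := by
    intro u v hu huv hv
    have e := (imgMeas_slice F hFc hF0 hF1 u v hu hv).trans
      ((by rw [hImg]) : _ = _) |>.trans (imgMeas_slice G hGc hG0 hG1 u v hu hv).symm
    have e1 : {x | u < F x ∧ F x ≤ v} = Ioc (p u) (p v) := by
      ext x; simp only [mem_ofPred_eq, mem_Ioc, ← not_le, hp u hu (huv.trans hv), hp v (hu.trans huv) hv]
    have e2 : {x | u < G x ∧ G x ≤ v} = Ioc (q u) (q v) := by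
      ext x; simp only [mem_ofPred_eq, mem_Ioc, ← not_le, hq u hu (huv.trans hv), hq v (hu.trans huv) hv]
    rw [e1, e2, Real.volume_Ioc, Real.volume_Ioc] at e
    have a1 : p u ≤ p v := (hp v (hu.trans huv) hv _).1 (by rw [hp' u hu (huv.trans hv)]; exact huv.le)
    have a2 : q u ≤ q v := (hq v (hu.trans huv) hv _).1 (by rw [hq' u hu (huv.trans hv)]; exact huv.le)
    exact (ENNReal.ofReal_eq_ofReal_iff (by linarith) (by linarith)).1 e
  have key2 : ∀ u, 0 < u → u < 1 → q u = p u + (q (1/2) - p (1/2)) := by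
    intro u h0 h1
    rcases lt_trichotomy u (1/2) with h | h | h
    · linarith [key u (1/2) h0 h (by norm_num)]
    · subst h; ring
    · linarith [key (1/2) u (by norm_num) h h1]
  refine ⟨q (1/2) - p (1/2), fun x => ?_⟩
  have hiff : ∀ u, 0 < u → u < 1 → (F x ≤ u ↔ G (x + (q (1/2) - p (1/2))) ≤ u) := by
    intro u h0 h1
    rw [hp u h0 h1, hq u h0 h1, key2 u h0 h1]; simp
  generalize G (x + (q (1/2) - p (1/2))) = b, hG0 (x + (q (1/2) - p (1/2))) = b0, hG1 (x + (q (1/2) - p (1/2))) = b1 at hiff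
  rcases lt_trichotomy b (F x) with h | h | h
  · have := (hiff ((b + F x)/2) (by linarith) (by linarith [hF1 x])).2 (by linarith)
    linarith
  · exact h
  · have := (hiff ((b + F x)/2) (by linarith [hF0 x]) (by linarith)).1 (by linarith)
    linarith

theorem laws_eq (μ ν : Measure ℝ) [IsProbabilityMeasure μ] [IsProbabilityMeasure ν] (F G : ℝ → ℝ)
    (hF : ∀ x, F x = μ.real (Iic x)) (hG : ∀ x, G x = ν.real (Iic x))
    (hFc : Continuous F) (hGc : Continuous G)
    (hfinX : Integrable (fun x : ℝ => F x * Real.log (F x)) (volume : Measure ℝ))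
    (hfinY : Integrable (fun x : ℝ => G x * Real.log (G x)) (volume : Measure ℝ))
    (m m' : ℝ → ℝ)
    (hm : ∀ t, m t = if 0 < F t then (∫ x in Iic t, F x) / F t else 0)
    (hm' : ∀ t, m' t = if 0 < G t then (∫ x in Iic t, G x) / G t else 0)
    (heq : ∀ n : ℕ, ∫ t, ((1 - (1 - F t) ^ (n + 1)) / F t) * m t ∂μ
      = ∫ t, ((1 - (1 - G t) ^ (n + 1)) / G t) * m' t ∂ν) :
    ∃ c : ℝ, ∀ x, G (x + c) = F x := by
  obtain ⟨-, hF0, hF1, -, -⟩ := cdf_facts μ F hF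
  obtain ⟨-, hG0, hG1, -, -⟩ := cdf_facts ν G hG
  obtain ⟨b, hb, hbF⟩ := lemA2 μ F hF hFc hfinX m hm
  obtain ⟨d, hd, hdG⟩ := lemA2 ν G hG hGc hfinY m' hm'
  have hs : ∀ n, ∑ k ∈ Finset.range n, b k = ∑ k ∈ Finset.range n, d k := by
    intro n
    cases n with
    | zero => simp
    | succ n => rw [← hb, ← hd, heq]
  have hbd : ∀ n, b n = d n := by
    intro n
    have := hs (n + 1)
    rw [Finset.sum_range_succ, Finset.sum_range_succ, hs n] at this
    linarith
  obtain ⟨f1, s1, k1⟩ := imgMeas_moment F hFc hF0 hF1 (F_one_sub_integrable μ F hF hFc hfinX)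
  obtain ⟨f2, s2, k2⟩ := imgMeas_moment G hGc hG0 hG1 (F_one_sub_integrable ν G hG hGc hfinY)
  refine law_shift μ ν F G hF hG hFc hGc (moments_determine _ _ s1 s2 fun n => ?_)
  rw [k1, k2]
  have := hbF n
  rw [hbd, hbd, hdG] at this
  have hn : (n : ℝ) + 1 ≠ 0 := by positivity
  exact ((div_left_inj' hn).1 this).symm

/-- If two integrable real random variables with continuous cdfs and finite
cumulative entropy `Δ_0` have the same dual cumulative Tsallis entropies `∇_n` for every
integer `n ≥ 0`, then they have the same law up to translation. -/
theorem dual_cumulative_tsallis_entropies_determine_law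
    {Ω : Type*} [MeasureSpace Ω] [IsProbabilityMeasure (volume : Measure Ω)]
    {Ω' : Type*} [MeasureSpace Ω'] [IsProbabilityMeasure (volume : Measure Ω')]
    (X : Ω → ℝ) (hXm : Measurable X) (hXint : Integrable X)
    (Y : Ω' → ℝ) (hYm : Measurable Y) (hYint : Integrable Y)
    (F G : ℝ → ℝ)
    (hF : ∀ x, F x = ((volume : Measure Ω) {ω | X ω ≤ x}).toReal)
    (hG : ∀ x, G x = ((volume : Measure Ω') {ω | Y ω ≤ x}).toReal)
    (hFcont : Continuous F) (hGcont : Continuous G)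
    (hfinX : Integrable (fun x : ℝ => F x * Real.log (F x)) (volume : Measure ℝ))
    (hfinY : Integrable (fun x : ℝ => G x * Real.log (G x)) (volume : Measure ℝ))
    (mbarX mbarY : ℝ → ℝ)
    (hmbarX : ∀ t, mbarX t = if 0 < F t then (∫ x in Iic t, F x) / F t else 0)
    (hmbarY : ∀ t, mbarY t = if 0 < G t then (∫ x in Iic t, G x) / G t else 0)
    (heq : ∀ n : ℕ,
      (∫ ω, ((1 - (1 - F (X ω)) ^ (n + 1)) / F (X ω)) * mbarX (X ω) ∂(volume : Measure Ω))
        = ∫ ω, ((1 - (1 - G (Y ω)) ^ (n + 1)) / G (Y ω)) * mbarY (Y ω)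
            ∂(volume : Measure Ω')) :
    ∃ c : ℝ, Measure.map Y (volume : Measure Ω')
      = Measure.map (fun ω => X ω + c) (volume : Measure Ω) := by
  have pX : IsProbabilityMeasure (Measure.map X (volume : Measure Ω)) :=
    Measure.isProbabilityMeasure_map hXm.aemeasurable
  have pY : IsProbabilityMeasure (Measure.map Y (volume : Measure Ω')) :=
    Measure.isProbabilityMeasure_map hYm.aemeasurable
  have hF' : ∀ x, F x = (Measure.map X (volume : Measure Ω)).real (Iic x) := fun x => by
    rw [hF, Measure.real, Measure.map_apply hXm measurableSet_Iic]; rfl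
  have hG' : ∀ x, G x = (Measure.map Y (volume : Measure Ω')).real (Iic x) := fun x => by
    rw [hG, Measure.real, Measure.map_apply hYm measurableSet_Iic]; rfl
  have i1 := (lemA _ F hF' hFcont hfinX mbarX hmbarX).1.aestronglyMeasurable
  have i2 := (lemA _ G hG' hGcont hfinY mbarY hmbarY).1.aestronglyMeasurable
  have hFm := hFcont.measurable
  have hGm := hGcont.measurable
  obtain ⟨c, hcc⟩ := laws_eq _ _ F G hF' hG' hFcont hGcont hfinX hfinY mbarX mbarY hmbarX hmbarY
    (fun n => by
      have j1 : AEStronglyMeasurable (fun t => ((1 - (1 - F t) ^ (n + 1)) / F t) * mbarX t)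
          (Measure.map X (volume : Measure Ω)) :=
        AEStronglyMeasurable.mul (Measurable.aestronglyMeasurable (by fun_prop)) i1
      have j2 : AEStronglyMeasurable (fun t => ((1 - (1 - G t) ^ (n + 1)) / G t) * mbarY t)
          (Measure.map Y (volume : Measure Ω')) :=
        AEStronglyMeasurable.mul (Measurable.aestronglyMeasurable (by fun_prop)) i2
      rw [integral_map hXm.aemeasurable j1, integral_map hYm.aemeasurable j2]
      exact heq n)
  refine ⟨c, Measure.ext_of_Iic _ _ fun y => ?_⟩
  have e1 : (Measure.map Y (volume : Measure Ω')) (Iic y) = ENNReal.ofReal (G y) := by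
    rw [hG']; simp
  have e2 : Measure.map (fun ω => X ω + c) (volume : Measure Ω) (Iic y)
      = (Measure.map X (volume : Measure Ω)) (Iic (y - c)) := by
    rw [Measure.map_apply (by fun_prop) measurableSet_Iic,
      Measure.map_apply hXm measurableSet_Iic]
    congr 1
    ext ω; simp [le_sub_iff_add_le]
  have e3 : (Measure.map X (volume : Measure Ω)) (Iic (y - c)) = ENNReal.ofReal (F (y - c)) := by
    rw [hF']; simp
  rw [e1, e2, e3, ← hcc (y - c), sub_add_cancel]
end

section
/- Let s > −1 and let X be a real random variable with finite expectation and continuous cumulative distribution function F, with tail F̄ = 1 − F and mean residual life mrl(t) = (1/F̄(t)) ∫_t^∞ F̄(x) dx. If Δ̄_s(X) = Δ_s(−X) < ∞, then E[X] + Δ̄_s(X) = (s+1) · E[ F̄(X)^s · (X + mrl(X)) ]; and if Δ̄_0(X) = −∫_ℝ F̄ log F̄ dx < ∞, then E[X] + ∇̄_s(X) = (s+1) · E[ F(X)^s · (X + mrl(X)) ], where ∇̄_s(X) = ∇_s(−X). -/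
open MeasureTheory Set

/-- The integrand `t ↦ (1/s) t (1 − t^s)` of the cumulative Tsallis entropy, with the
convention `(1 − t^0)/0 = −log t` at `s = 0`. -/
noncomputable def tsallisFn (s t : ℝ) : ℝ :=
  if s = 0 then -(t * Real.log t) else (1 / s) * (t * (1 - t ^ s))

open Filter Topology

section aux
variable {Ω : Type*} [MeasurableSpace Ω]

lemma aux_anti (ν : Measure Ω) [IsFiniteMeasure ν] (f : Ω → ℝ) :
    Antitone (fun x : ℝ => ν.real {a | x < f a}) := fun x y h =>
  measureReal_mono (fun a (ha : y < f a) => lt_of_le_of_lt h ha)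

lemma aux_mono (ν : Measure Ω) [IsFiniteMeasure ν] (f : Ω → ℝ) :
    Monotone (fun x : ℝ => ν.real {a | f a ≤ x}) := fun x y h =>
  measureReal_mono (fun a (ha : f a ≤ x) => le_trans ha h)

lemma layer_pos (ν : Measure Ω) [IsFiniteMeasure ν] {f : Ω → ℝ} (hf : Measurable f) :
    ∫⁻ a, ENNReal.ofReal (f a) ∂ν = ∫⁻ x in Ioi (0:ℝ), ENNReal.ofReal (ν.real {a | x < f a}) := by
  have h := lintegral_eq_lintegral_meas_lt (f := fun a => max (f a) 0) ν
    (Eventually.of_forall fun a => le_max_right _ _) (by fun_prop)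
  have e : ∀ a, ENNReal.ofReal (max (f a) 0) = ENNReal.ofReal (f a) := fun a => by
    simp [ENNReal.ofReal_max]
  simp only [e] at h
  rw [h]
  refine setLIntegral_congr_fun measurableSet_Ioi fun x hx => ?_
  simp only [mem_Ioi] at hx
  simp [not_lt.2 hx.le]

lemma layer_neg (ν : Measure Ω) [IsFiniteMeasure ν] {f : Ω → ℝ} (hf : Measurable f) :
    ∫⁻ a, ENNReal.ofReal (-f a) ∂ν = ∫⁻ x in Iic (0:ℝ), ENNReal.ofReal (ν.real {a | f a ≤ x}) := by
  have h := lintegral_eq_lintegral_meas_le (f := fun a => max (-f a) 0) ν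
    (Eventually.of_forall fun a => le_max_right _ _) (by fun_prop)
  have e : ∀ a, ENNReal.ofReal (max (-f a) 0) = ENNReal.ofReal (-f a) := fun a => by
    simp [ENNReal.ofReal_max]
  simp only [e] at h
  rw [h]
  have h2 := (Measure.measurePreserving_neg (volume : Measure ℝ)).setLIntegral_comp_preimage
    (s := Iio (0:ℝ)) measurableSet_Iio
    (f := fun x => ENNReal.ofReal (ν.real {a | f a ≤ x})) (aux_mono ν f).measurable.ennreal_ofReal
  rw [setLIntegral_congr (Iio_ae_eq_Iic (a := (0:ℝ)) (μ := volume)).symm, ← h2]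
  have e2 : (Neg.neg ⁻¹' (Iio (0:ℝ))) = Ioi 0 := by ext x; simp
  rw [e2]
  refine setLIntegral_congr_fun measurableSet_Ioi fun x hx => ?_
  simp only [mem_Ioi] at hx
  simp [not_le.2 hx, le_neg]

lemma layer_integrable (ν : Measure Ω) [IsFiniteMeasure ν] {f : Ω → ℝ} (hf : Measurable f)
    (h1 : IntegrableOn (fun x => ν.real {a | x < f a}) (Ioi 0))
    (h2 : IntegrableOn (fun x => ν.real {a | f a ≤ x}) (Iic 0)) : Integrable f ν := by
  refine ⟨hf.aestronglyMeasurable, ?_⟩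
  rw [hasFiniteIntegral_iff_norm]
  have e : ∀ a, ENNReal.ofReal ‖f a‖ = ENNReal.ofReal (f a) + ENNReal.ofReal (-f a) := fun a => by
    rcases le_total 0 (f a) with h | h
    · rw [Real.norm_of_nonneg h, ENNReal.ofReal_of_nonpos (neg_nonpos.2 h), add_zero]
    · rw [Real.norm_of_nonpos h, ENNReal.ofReal_of_nonpos h, zero_add]
  simp only [e]
  rw [lintegral_add_left (by fun_prop), layer_pos ν hf, layer_neg ν hf]
  exact ENNReal.add_lt_top.2 ⟨Integrable.lintegral_lt_top h1, Integrable.lintegral_lt_top h2⟩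

lemma layer_integrable_conv (ν : Measure Ω) [IsFiniteMeasure ν] {f : Ω → ℝ} (hf : Measurable f)
    (hi : Integrable f ν) :
    IntegrableOn (fun x => ν.real {a | x < f a}) (Ioi 0) ∧
    IntegrableOn (fun x => ν.real {a | f a ≤ x}) (Iic 0) := by
  constructor
  · refine ⟨(aux_anti ν f).measurable.aestronglyMeasurable, ?_⟩
    rw [hasFiniteIntegral_iff_ofReal (Eventually.of_forall fun x => measureReal_nonneg),
      ← layer_pos ν hf]
    exact Integrable.lintegral_lt_top hi
  · refine ⟨(aux_mono ν f).measurable.aestronglyMeasurable, ?_⟩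
    rw [hasFiniteIntegral_iff_ofReal (Eventually.of_forall fun x => measureReal_nonneg),
      ← layer_neg ν hf]
    exact Integrable.lintegral_lt_top hi.neg

lemma layer_integral (ν : Measure Ω) [IsFiniteMeasure ν] {f : Ω → ℝ} (hf : Measurable f)
    (hi : Integrable f ν) :
    ∫ a, f a ∂ν = (∫ x in Ioi (0:ℝ), ν.real {a | x < f a}) - ∫ x in Iic (0:ℝ), ν.real {a | f a ≤ x} := by
  rw [integral_eq_lintegral_pos_part_sub_lintegral_neg_part hi, layer_pos ν hf, layer_neg ν hf,
    integral_eq_lintegral_of_nonneg_ae (Eventually.of_forall fun x => measureReal_nonneg)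
      (aux_anti ν f).measurable.aestronglyMeasurable,
    integral_eq_lintegral_of_nonneg_ae (Eventually.of_forall fun x => measureReal_nonneg)
      (aux_mono ν f).measurable.aestronglyMeasurable]

/-- Stop-loss transform. -/
lemma stop_loss (ν : Measure Ω) [IsFiniteMeasure ν] {f : Ω → ℝ} (hf : Measurable f)
    (hi : Integrable f ν) (t : ℝ) :
    ∫ x in Ioi t, ν.real {a | x < f a} =
      (∫ a, {a | t < f a}.indicator f a ∂ν) - t * ν.real {a | t < f a} := by
  have hs : MeasurableSet {a | t < f a} := measurableSet_lt measurable_const hf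
  have h0 : Integrable (fun a => max (f a - t) 0) ν :=
    (hi.sub (integrable_const t)).pos_part
  have h := h0.integral_eq_integral_meas_lt (Eventually.of_forall fun a => le_max_right _ _)
  have e : (fun a => max (f a - t) 0) =
      fun a => {a | t < f a}.indicator f a - {a | t < f a}.indicator (fun _ => t) a := by
    funext a
    by_cases ha : t < f a
    · simp [ha, ha.le]
    · simp [ha, not_lt.1 ha]
  rw [e, integral_sub (hi.indicator hs) ((integrable_const t).indicator hs),
    integral_indicator_const _ hs] at h
  rw [smul_eq_mul, mul_comm] at h
  rw [h]
  have h2 := (measurePreserving_add_right (volume : Measure ℝ) t).setIntegral_preimage_emb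
    (measurableEmbedding_addRight t) (fun x => ν.real {a | x < f a}) (Ioi t)
  rw [← h2]
  have e2 : ((fun x => x + t) ⁻¹' (Ioi t)) = Ioi 0 := by ext x; simp
  rw [e2]
  refine setIntegral_congr_fun measurableSet_Ioi fun x hx => ?_
  simp only [mem_Ioi] at hx
  have : {a | x + t < f a} = {a | x < {a | t < f a}.indicator f a -
      {a | t < f a}.indicator (fun _ => t) a} := by
    ext a
    have := congrFun e a
    simp only [mem_ofPred_eq] at this ⊢
    rw [← this, lt_max_iff]
    constructor
    · intro h; left; linarith
    · rintro (h | h) <;> linarith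
  have e3 : ∀ a, max (f a - t) 0 = _ := congrFun e
  simp only [this, e3]

end aux

section unif
open ProbabilityTheory
variable {Ω : Type*} [MeasurableSpace Ω]

lemma unif_map (μ : Measure Ω) [IsProbabilityMeasure μ] {X : Ω → ℝ} (hX : Measurable X)
    {F : ℝ → ℝ} (hF : ∀ x, F x = μ.real {ω | X ω ≤ x}) (hFc : Continuous F) :
    μ.map (fun ω => F (X ω)) = (volume : Measure ℝ).restrict (Ioo 0 1) := by
  have : IsProbabilityMeasure (μ.map X) := Measure.isProbabilityMeasure_map hX.aemeasurable
  have hcdf : (cdf (μ.map X) : ℝ → ℝ) = F := by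
    funext x
    rw [cdf_eq_real, hF, map_measureReal_apply hX measurableSet_Iic]; rfl
  have hbot : Tendsto F atBot (𝓝 0) := hcdf ▸ tendsto_cdf_atBot _
  have htop : Tendsto F atTop (𝓝 1) := hcdf ▸ tendsto_cdf_atTop _
  have hmono : Monotone F := hcdf ▸ monotone_cdf _
  have h0 : ∀ x, 0 ≤ F x := fun x => by rw [hF]; exact measureReal_nonneg
  have h1 : ∀ x, F x ≤ 1 := fun x => by rw [hF]; exact measureReal_le_one
  have hm : Measurable fun ω => F (X ω) := hFc.measurable.comp hX
  have : IsProbabilityMeasure (μ.map fun ω => F (X ω)) :=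
    Measure.isProbabilityMeasure_map hm.aemeasurable
  refine Measure.ext_of_Iic _ _ fun u => ?_
  rw [Measure.map_apply hm measurableSet_Iic, Measure.restrict_apply measurableSet_Iic]
  change μ {ω | F (X ω) ≤ u} = _
  rcases lt_or_ge u 0 with hu | hu
  · have e1 : {ω | F (X ω) ≤ u} = ∅ := by
      ext ω; simp only [mem_ofPred_eq, mem_empty_iff_false, iff_false, not_le]
      exact lt_of_lt_of_le hu (h0 _)
    have e2 : Iic u ∩ Ioo 0 1 = ∅ := by
      ext y; simp only [mem_inter_iff, mem_Iic, mem_Ioo, mem_empty_iff_false, iff_false]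
      rintro ⟨a, b, c⟩; linarith
    rw [e1, e2]; simp
  rcases le_or_gt 1 u with hu1 | hu1
  · have e1 : {ω | F (X ω) ≤ u} = univ := by
      ext ω; simp only [mem_ofPred_eq, mem_univ, iff_true]
      exact (h1 _).trans hu1
    have e2 : Iic u ∩ Ioo 0 1 = Ioo 0 1 := by
      ext y; simp only [mem_inter_iff, mem_Iic, mem_Ioo, and_iff_right_iff_imp]
      rintro ⟨b, c⟩; linarith
    rw [e1, e2]; simp
  have e2 : volume (Iic u ∩ Ioo 0 1) = ENNReal.ofReal u := by
    have : Iic u ∩ Ioo 0 1 = Ioc 0 u := by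
      ext y; simp only [mem_inter_iff, mem_Iic, mem_Ioo, mem_Ioc]
      constructor
      · rintro ⟨a, b, c⟩; exact ⟨b, a⟩
      · rintro ⟨a, b⟩; exact ⟨b, a, by linarith⟩
    rw [this]; simp
  rw [e2]
  by_cases hne : {x | F x ≤ u}.Nonempty
  · have hbdd : BddAbove {x | F x ≤ u} := by
      obtain ⟨b, hb⟩ := (htop.eventually (lt_mem_nhds hu1)).exists
      refine ⟨b, fun x hx => ?_⟩
      by_contra hlt
      exact absurd (hmono (not_le.1 hlt).le) (not_le.2 (lt_of_le_of_lt hx hb))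
    have hcl : IsClosed {x | F x ≤ u} := isClosed_le hFc continuous_const
    set c := sSup {x | F x ≤ u} with hc
    have hcm : F c ≤ u := hcl.csSup_mem hne hbdd
    have hcu : F c = u := by
      refine le_antisymm hcm ?_
      by_contra hlt
      have hev : ∀ᶠ y in 𝓝 c, F y < u := hFc.continuousAt.eventually (gt_mem_nhds (not_le.1 hlt))
      obtain ⟨y, hy, hyc⟩ := ((hev.filter_mono nhdsWithin_le_nhds).and
        (self_mem_nhdsWithin : Ioi c ∈ 𝓝[>] c)).exists
      exact absurd (le_csSup hbdd (show y ∈ {x | F x ≤ u} from hy.le)) (not_le.2 hyc)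
    have e1 : {ω | F (X ω) ≤ u} = {ω | X ω ≤ c} := by
      ext ω
      exact ⟨fun h => le_csSup hbdd h, fun h => (hmono h).trans hcm⟩
    rw [e1, ← hcu, hF, ofReal_measureReal]
  · have hu0 : u = 0 := by
      by_contra hne0
      have : 0 < u := lt_of_le_of_ne hu (Ne.symm hne0)
      obtain ⟨b, hb⟩ := (hbot.eventually (gt_mem_nhds this)).exists
      exact hne ⟨b, hb.le⟩
    have e1 : {ω | F (X ω) ≤ u} = ∅ := by
      ext ω; simp only [mem_ofPred_eq, mem_empty_iff_false, iff_false]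
      exact fun h => hne ⟨_, h⟩
    rw [e1, hu0]; simp

lemma F_mono (μ : Measure Ω) [IsProbabilityMeasure μ] {X : Ω → ℝ} 
    {F : ℝ → ℝ} (hF : ∀ x, F x = μ.real {ω | X ω ≤ x}) : Monotone F := by
  have := aux_mono μ X
  intro x y h; rw [hF, hF]; exact this h

lemma unif_ae (μ : Measure Ω) [IsProbabilityMeasure μ] {X : Ω → ℝ} (hX : Measurable X)
    {F : ℝ → ℝ} (hF : ∀ x, F x = μ.real {ω | X ω ≤ x}) (hFc : Continuous F) :
    ∀ᵐ ω ∂μ, 0 < F (X ω) ∧ F (X ω) < 1 := by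
  have hm : Measurable fun ω => F (X ω) := hFc.measurable.comp hX
  have h : ∀ᵐ u ∂(μ.map fun ω => F (X ω)), u ∈ Ioo (0:ℝ) 1 := by
    rw [unif_map μ hX hF hFc]; exact ae_restrict_mem measurableSet_Ioo
  exact ae_of_ae_map hm.aemeasurable h

lemma le_ae_eq (μ : Measure Ω) [IsProbabilityMeasure μ] {X : Ω → ℝ} (hX : Measurable X)
    {F : ℝ → ℝ} (hF : ∀ x, F x = μ.real {ω | X ω ≤ x}) (hFc : Continuous F) (x : ℝ) :
    {ω | X ω ≤ x} =ᵐ[μ] {ω | F (X ω) < F x} ∧ {ω | X ω < x} =ᵐ[μ] {ω | F (X ω) < F x} := by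
  have hm : Measurable fun ω => F (X ω) := hFc.measurable.comp hX
  have hmono := F_mono μ hF
  have h0 : μ {ω | F (X ω) = F x} = 0 := by
    have : μ.map (fun ω => F (X ω)) {F x} = 0 := by
      rw [unif_map μ hX hF hFc]; simp
    rwa [Measure.map_apply hm (measurableSet_singleton _)] at this
  have h0' : ∀ᵐ ω ∂μ, F (X ω) ≠ F x := by rw [ae_iff]; simpa using h0
  constructor
  · filter_upwards [h0'] with ω hω
    refine propext ⟨fun h => lt_of_le_of_ne (hmono h) hω, fun h => ?_⟩
    by_contra hlt
    exact absurd (hmono (not_le.1 hlt).le) (not_le.2 h)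
  · filter_upwards [h0'] with ω hω
    refine propext ⟨fun h => lt_of_le_of_ne (hmono (le_of_lt h)) hω, fun h => ?_⟩
    by_contra hlt
    exact absurd (hmono (not_lt.1 hlt)) (not_le.2 h)

lemma lint_below (μ : Measure Ω) [IsProbabilityMeasure μ] {X : Ω → ℝ} (hX : Measurable X)
    {F : ℝ → ℝ} (hF : ∀ x, F x = μ.real {ω | X ω ≤ x}) (hFc : Continuous F) 
    {g : ℝ → ENNReal} (hg : Measurable g) {s : Set ℝ} (hs : MeasurableSet s) :
    ∫⁻ ω in {ω | F (X ω) ∈ s}, g (F (X ω)) ∂μ = ∫⁻ u in s ∩ Ioo 0 1, g u := by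
  have hm : Measurable fun ω => F (X ω) := hFc.measurable.comp hX
  have := setLIntegral_map (μ := μ) hs hg hm
  rw [unif_map μ hX hF hFc, Measure.restrict_restrict hs] at this
  exact this.symm

end unif

section fub
variable {Ω : Type*} [MeasurableSpace Ω]

lemma aux_inter {v : ℝ} (hv : v ≤ 1) : Iio v ∩ Ioo 0 1 = Ioo 0 v := by
  ext y; simp only [mem_inter_iff, mem_Iio, mem_Ioo]
  constructor
  · rintro ⟨a, b, c⟩; exact ⟨b, a⟩
  · rintro ⟨a, b⟩; exact ⟨b, a, by linarith⟩

lemma fubini_mrl (μ : Measure Ω) [IsProbabilityMeasure μ] {X : Ω → ℝ} (hX : Measurable X)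
    {F : ℝ → ℝ} (hF : ∀ x, F x = μ.real {ω | X ω ≤ x}) (hFc : Continuous F)
    {κ : ℝ → ℝ} (hκ : Measurable κ) (hκi : ∀ v, 0 < v → v < 1 → IntegrableOn κ (Ioo 0 v))
    {B : ℝ → ℝ} (hB : ∀ v, 0 < v → v < 1 → ∫ u in Ioo 0 v, |κ u| ≤ B v)
    (hBi : Integrable (fun ω => X ω * B (F (X ω))) μ) :
    Integrable (fun ω => κ (F (X ω)) * ∫ ω', {ω' | X ω < X ω'}.indicator X ω' ∂μ) μ ∧
    ∫ ω, κ (F (X ω)) * (∫ ω', {ω' | X ω < X ω'}.indicator X ω' ∂μ) ∂μ =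
      ∫ ω, X ω * (∫ u in Ioo 0 (F (X ω)), κ u) ∂μ ∧
    Integrable (fun ω => X ω * (∫ u in Ioo 0 (F (X ω)), κ u)) μ := by
  have hm : Measurable fun ω => F (X ω) := hFc.measurable.comp hX
  have h1 : ∀ x, F x ≤ 1 := fun x => by rw [hF]; exact measureReal_le_one
  let f : Ω → Ω → ℝ := fun ω ω' => κ (F (X ω)) * {ω' | X ω < X ω'}.indicator X ω'
  have hmeas : Measurable (Function.uncurry f) := by
    have e : Function.uncurry f = fun p : Ω × Ω => κ (F (X p.1)) *
        {p : Ω × Ω | X p.1 < X p.2}.indicator (fun p => X p.2) p := by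
      funext p; rfl
    rw [e]
    exact ((hκ.comp hm).comp measurable_fst).mul ((hX.comp measurable_snd).indicator
      (measurableSet_lt (hX.comp measurable_fst) (hX.comp measurable_snd)))
  have hswap : ∀ ω ω', f ω ω' = X ω' * {ω | X ω < X ω'}.indicator (fun ω => κ (F (X ω))) ω := by
    intro ω ω'
    by_cases h : X ω < X ω' <;> simp [f, h, mul_comm]
  have hms : ∀ x, MeasurableSet {ω | X ω < x} := fun x => measurableSet_lt hX measurable_const
  have hint : Integrable (Function.uncurry f) (μ.prod μ) := by
    refine ⟨hmeas.aestronglyMeasurable, ?_⟩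
    rw [hasFiniteIntegral_iff_enorm, lintegral_prod_symm _ hmeas.enorm.aemeasurable]
    refine lt_of_le_of_lt ?_ hBi.2
    refine lintegral_mono_ae ?_
    filter_upwards [unif_ae μ hX hF hFc] with ω' hω'
    simp only [Function.uncurry_apply_pair, hswap, enorm_mul]
    rw [lintegral_const_mul' _ _ (by simp)]
    refine mul_le_mul_right ?_ _
    simp only [enorm_indicator_eq_indicator_enorm]
    have hb := lint_below μ hX hF hFc hκ.enorm (measurableSet_Iio (a := F (X ω')))
    simp only [mem_Iio] at hb
    rw [lintegral_indicator (hms _), setLIntegral_congr (le_ae_eq μ hX hF hFc (X ω')).2,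
      hb, aux_inter hω'.2.le]
    have hi := hκi _ hω'.1 hω'.2
    have := ofReal_integral_eq_lintegral_ofReal hi.norm (Eventually.of_forall fun _ => norm_nonneg _)
    simp only [ofReal_norm] at this
    rw [← this]
    refine (ENNReal.ofReal_le_ofReal (hB _ hω'.1 hω'.2)).trans ?_
    rw [← ofReal_norm]
    exact ENNReal.ofReal_le_ofReal (le_abs_self _)
  have ef : ∀ ω, ∫ ω', f ω ω' ∂μ = κ (F (X ω)) * ∫ ω', {ω' | X ω < X ω'}.indicator X ω' ∂μ :=
    fun ω => integral_const_mul _ _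
  have eg : ∀ ω', ∫ ω, f ω ω' ∂μ = X ω' * (∫ u in Ioo 0 (F (X ω')), κ u) := by
    intro ω'
    simp only [hswap]
    rw [integral_const_mul, integral_indicator (hms _),
      setIntegral_congr_set (le_ae_eq μ hX hF hFc (X ω')).2, ← aux_inter (h1 (X ω')),
      ← Measure.restrict_restrict measurableSet_Iio, ← unif_map μ hX hF hFc,
      setIntegral_map measurableSet_Iio hκ.aestronglyMeasurable hm.aemeasurable]
    rfl
  refine ⟨?_, ?_, ?_⟩
  · have := hint.integral_prod_left
    simpa only [Function.uncurry_apply_pair, ef] using this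
  · simp only [← ef, ← eg]
    exact integral_integral_swap hint
  · have := hint.integral_prod_right
    simpa only [Function.uncurry_apply_pair, eg] using this

end fub

/-- Weight attached to the residual Tsallis entropy. -/
noncomputable def psiFn (s v : ℝ) : ℝ :=
  if s = 0 then -Real.log (1 - v) else (s + 1) / s * (1 - (1 - v) ^ s)

section calculus

lemma ftc_nonneg {G g : ℝ → ℝ} {a b : ℝ} (hab : a ≤ b) (hc : ContinuousOn G (Icc a b))
    (hd : ∀ x ∈ Ioo a b, HasDerivAt G (g x) x) (hn : ∀ x ∈ Ioo a b, 0 ≤ g x) :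
    IntegrableOn g (Ioo a b) ∧ ∫ x in Ioo a b, g x = G b - G a := by
  have h := intervalIntegral.integrableOn_deriv_of_nonneg hc hd hn
  refine ⟨h.mono_set Ioo_subset_Ioc_self, ?_⟩
  rw [← integral_Ioc_eq_integral_Ioo, ← intervalIntegral.integral_of_le hab]
  exact intervalIntegral.integral_eq_sub_of_hasDerivAt_of_le hab hc hd
    ((intervalIntegrable_iff_integrableOn_Ioc_of_le hab).2 h)

lemma psi_deriv (s : ℝ) {v : ℝ} (hv : v < 1) :
    HasDerivAt (psiFn s) ((s + 1) * (1 - v) ^ (s - 1)) v := by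
  have hpos : 0 < 1 - v := by linarith
  have h1 : HasDerivAt (fun v : ℝ => 1 - v) (-1) v := by
    simpa using (hasDerivAt_id v).const_sub 1
  by_cases hs : s = 0
  · subst hs
    have e : psiFn 0 = fun v => -Real.log (1 - v) := by funext v; simp [psiFn]
    rw [e]
    refine HasDerivAt.congr_deriv (h1.log hpos.ne').neg ?_
    rw [zero_sub, Real.rpow_neg_one]; field_simp; ring
  · have e : psiFn s = fun v => (s + 1) / s * (1 - (1 - v) ^ s) := by funext v; simp [psiFn, hs]
    rw [e]
    refine HasDerivAt.congr_deriv
      (((h1.rpow_const (p := s) (Or.inl hpos.ne')).const_sub 1).const_mul ((s + 1) / s)) ?_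
    field_simp

lemma psi_zero (s : ℝ) : psiFn s 0 = 0 := by
  by_cases hs : s = 0 <;> simp [psiFn, hs]

lemma psi_integral {s : ℝ} (hs : -1 < s) {v : ℝ} (h0 : 0 < v) (h1 : v < 1) :
    IntegrableOn (fun u : ℝ => (s + 1) * (1 - u) ^ (s - 1)) (Ioo 0 v) ∧
    ∫ u in Ioo 0 v, (s + 1) * (1 - u) ^ (s - 1) = psiFn s v := by
  have := ftc_nonneg (G := psiFn s) (g := fun u : ℝ => (s + 1) * (1 - u) ^ (s - 1)) h0.le
    (fun x hx => (psi_deriv s (lt_of_le_of_lt hx.2 h1)).continuousAt.continuousWithinAt)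
    (fun x hx => psi_deriv s (hx.2.trans h1))
    (fun x hx => mul_nonneg (by linarith) (Real.rpow_nonneg (by linarith [hx.2]) _))
  simpa [psi_zero] using this

lemma psi_nonneg {s : ℝ} (hs : -1 < s) {v : ℝ} (h0 : 0 < v) (h1 : v < 1) : 0 ≤ psiFn s v := by
  rw [← (psi_integral hs h0 h1).2]
  exact setIntegral_nonneg measurableSet_Ioo fun x hx =>
    mul_nonneg (by linarith) (Real.rpow_nonneg (by linarith [hx.2]) _)

lemma psi_meas (s : ℝ) : Measurable (psiFn s) := by
  by_cases hs : s = 0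
  · have e : psiFn s = fun v => -Real.log (1 - v) := by funext v; simp [psiFn, hs]
    rw [e]; fun_prop
  · have e : psiFn s = fun v => (s + 1) / s * (1 - (1 - v) ^ s) := by funext v; simp [psiFn, hs]
    rw [e]; fun_prop

lemma tsallis_cont {s : ℝ} (hs : -1 < s) : ContinuousOn (tsallisFn s) (Ici 0) := by
  by_cases h : s = 0
  · have e : tsallisFn s = fun t => -(t * Real.log t) := by funext t; simp [tsallisFn, h]
    rw [e]; exact Real.continuous_mul_log.neg.continuousOn
  · have e : EqOn (tsallisFn s) (fun t => (1 / s) * (t - t ^ (s + 1))) (Ici 0) := by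
      intro t ht
      simp only [tsallisFn, h, if_false]
      rw [Real.rpow_add_one' ht (by linarith)]; ring
    refine ContinuousOn.congr ?_ e
    exact (continuous_const.mul (continuous_id.sub
      (Real.continuous_rpow_const (by linarith)))).continuousOn

lemma tsallis_deriv (s : ℝ) {v : ℝ} (hv : v < 1) :
    HasDerivAt (fun v => -(tsallisFn s (1 - v) + (1 - v))) (psiFn s v) v := by
  have hpos : 0 < 1 - v := by linarith
  have h1 : HasDerivAt (fun v : ℝ => 1 - v) (-1) v := by
    simpa using (hasDerivAt_id v).const_sub 1
  by_cases hs : s = 0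
  · simp only [tsallisFn, psiFn, hs, if_true]
    refine HasDerivAt.congr_deriv (((h1.mul (h1.log hpos.ne')).neg).add h1).neg ?_
    field_simp; ring
  · simp only [tsallisFn, psiFn, hs, if_false]
    have := (((h1.mul ((h1.rpow_const (p := s) (Or.inl hpos.ne')).const_sub 1)).const_mul
      (1 / s)).add h1).neg
    refine HasDerivAt.congr_deriv this ?_
    have e : (1 - v) ^ s = (1 - v) ^ (s - 1) * (1 - v) := by
      rw [← Real.rpow_add_one hpos.ne']; congr 1; ring
    rw [e]
    field_simp; ring

lemma psi_int2 {s : ℝ} (hs : -1 < s) {v : ℝ} (h0 : 0 ≤ v) (h1 : v ≤ 1) :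
    IntegrableOn (psiFn s) (Ioo 0 v) ∧
    ∫ u in Ioo 0 v, psiFn s u = v - tsallisFn s (1 - v) := by
  have hc : ContinuousOn (fun v => -(tsallisFn s (1 - v) + (1 - v))) (Icc 0 v) := by
    refine ContinuousOn.neg (ContinuousOn.add ?_ (by fun_prop))
    exact (tsallis_cont hs).comp (by fun_prop) (fun x hx => by simp; linarith [hx.2])
  have := ftc_nonneg (g := psiFn s) h0 hc
    (fun x hx => tsallis_deriv s (lt_of_lt_of_le hx.2 h1))
    (fun x hx => psi_nonneg hs hx.1 (lt_of_lt_of_le hx.2 h1))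
  refine ⟨this.1, this.2.trans ?_⟩
  have e : tsallisFn s 1 = 0 := by simp [tsallisFn]
  simp only [sub_zero, e]; ring

end calculus

section part1
variable {Ω : Type*} [MeasurableSpace Ω]

lemma split_int {g : ℝ → ℝ} (hg : Integrable g) :
    ∫ x, g x = (∫ x in Ioi (0:ℝ), g x) + ∫ x in Iic (0:ℝ), g x := by
  have := integral_add_compl (measurableSet_Ioi (a := (0:ℝ))) hg
  rw [compl_Ioi] at this
  exact this.symm

lemma weighted_mean (μ : Measure Ω) [IsProbabilityMeasure μ] {X : Ω → ℝ} (hX : Measurable X)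
    (hXi : Integrable X μ)
    {F : ℝ → ℝ} (hF : ∀ x, F x = μ.real {ω | X ω ≤ x}) (hFc : Continuous F)
    {s : ℝ} (hs : -1 < s) (hT : Integrable (fun x => tsallisFn s (1 - F x))) :
    Integrable (fun ω => X ω * psiFn s (F (X ω))) μ ∧
    ∫ ω, X ω * psiFn s (F (X ω)) ∂μ = ∫ ω, X ω ∂μ + ∫ x, tsallisFn s (1 - F x) := by
  have hm : Measurable fun ω => F (X ω) := hFc.measurable.comp hX
  have h0 : ∀ x, 0 ≤ F x := fun x => by rw [hF]; exact measureReal_nonneg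
  have h1 : ∀ x, F x ≤ 1 := fun x => by rw [hF]; exact measureReal_le_one
  set d : Ω → ENNReal := fun ω => ENNReal.ofReal (psiFn s (F (X ω))) with hd
  have hdm : Measurable d := ((psi_meas s).comp hm).ennreal_ofReal
  set ν := μ.withDensity d with hν
  have key : ∀ v, 0 ≤ v → v ≤ 1 → ∫⁻ u in Ioo 0 v, ENNReal.ofReal (psiFn s u) =
      ENNReal.ofReal (v - tsallisFn s (1 - v)) := by
    intro v hv0 hv1
    rw [← (psi_int2 hs hv0 hv1).2, ofReal_integral_eq_lintegral_ofReal (psi_int2 hs hv0 hv1).1]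
    filter_upwards [ae_restrict_mem measurableSet_Ioo] with u hu
    exact psi_nonneg hs hu.1 (lt_of_lt_of_le hu.2 hv1)
  have hnn : ∀ v, 0 ≤ v → v ≤ 1 → 0 ≤ v - tsallisFn s (1 - v) := by
    intro v hv0 hv1
    rw [← (psi_int2 hs hv0 hv1).2]
    exact setIntegral_nonneg measurableSet_Ioo fun u hu =>
      psi_nonneg hs hu.1 (lt_of_lt_of_le hu.2 hv1)
  have hle : ∀ x, ν {ω | X ω ≤ x} = ENNReal.ofReal (F x - tsallisFn s (1 - F x)) := by
    intro x
    have hb := lint_below μ hX hF hFc (psi_meas s).ennreal_ofReal (measurableSet_Iio (a := F x))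
    simp only [mem_Iio] at hb
    rw [hν, withDensity_apply _ (measurableSet_le hX measurable_const),
      setLIntegral_congr (le_ae_eq μ hX hF hFc x).1, hb, aux_inter (h1 x), key _ (h0 x) (h1 x)]
  have hprob : IsProbabilityMeasure ν := by
    constructor
    have hb := lint_below μ hX hF hFc (psi_meas s).ennreal_ofReal (MeasurableSet.univ)
    simp only [mem_univ, univ_inter, key 1 zero_le_one le_rfl] at hb
    rw [hν, withDensity_apply _ MeasurableSet.univ]
    have e : tsallisFn s 0 = 0 := by simp [tsallisFn]
    simpa [e] using hb
  have hleR : ∀ x, ν.real {ω | X ω ≤ x} = F x - tsallisFn s (1 - F x) := by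
    intro x
    rw [measureReal_def, hle, ENNReal.toReal_ofReal (hnn _ (h0 x) (h1 x))]
  have hcompl : ∀ (ρ : Measure Ω) [IsProbabilityMeasure ρ], ∀ x,
      ρ.real {ω | x < X ω} = 1 - ρ.real {ω | X ω ≤ x} := by
    intro ρ _ x
    rw [← probReal_compl_eq_one_sub (measurableSet_le hX measurable_const)]
    congr 1; ext ω; simp
  obtain ⟨g1, g2⟩ := layer_integrable_conv μ hX hXi
  simp only [hcompl μ, ← hF] at g1 g2
  have hT1 := hT.integrableOn (s := Ioi (0:ℝ))
  have hT2 := hT.integrableOn (s := Iic (0:ℝ))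
  have e1 : (fun x => ν.real {ω | x < X ω}) = fun x => (1 - F x) + tsallisFn s (1 - F x) := by
    funext x; rw [hcompl ν, hleR]; ring
  have hiν : Integrable X ν := by
    refine layer_integrable ν hX ?_ ?_
    · rw [e1]; exact g1.add hT1
    · simp only [hleR]; exact g2.sub hT2
  have hfin : ∀ᵐ ω ∂μ, d ω < ⊤ := Eventually.of_forall fun ω => ENNReal.ofReal_lt_top
  have hae : ∀ᵐ ω ∂μ, (d ω).toReal • X ω = X ω * psiFn s (F (X ω)) := by
    filter_upwards [unif_ae μ hX hF hFc] with ω hω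
    rw [hd, ENNReal.toReal_ofReal (psi_nonneg hs hω.1 hω.2), smul_eq_mul, mul_comm]
  constructor
  · exact ((integrable_withDensity_iff_integrable_smul' hdm hfin).1 hiν).congr hae
  · rw [← integral_congr_ae hae, ← integral_withDensity_eq_integral_toReal_smul hdm hfin,
      ← hν, layer_integral ν hX hiν, layer_integral μ hX hXi, split_int hT]
    have := congrFun e1
    simp only [this, hleR, hcompl μ, ← hF]
    rw [integral_add g1 hT1, integral_sub g2 hT2]
    ring

end part1

section part2

lemma dom_bound {s : ℝ} (hs : -1 < s) {g : ℝ → ℝ} (hg : Measurable g) {a b : ℝ} (ha : 0 ≤ a)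
    (hg0 : ∀ u, 0 < u → u < 1 → 0 ≤ g u)
    (hgb : ∀ u, 0 < u → u < 1 → g u ≤ a * ((s + 1) * u ^ s) + b * (1 - u)⁻¹)
    {v : ℝ} (h0 : 0 < v) (h1 : v < 1) :
    IntegrableOn g (Ioo 0 v) ∧ ∫ u in Ioo 0 v, |g u| ≤ a + b * psiFn 0 v := by
  have i1 := ftc_nonneg (G := fun u : ℝ => u ^ (s + 1)) (g := fun u => (s + 1) * u ^ s) h0.le
    (Real.continuous_rpow_const (by linarith)).continuousOn
    (fun x hx => by
      have := Real.hasDerivAt_rpow_const (x := x) (p := s + 1) (Or.inl hx.1.ne')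
      simpa using this)
    (fun x hx => mul_nonneg (by linarith) (Real.rpow_nonneg hx.1.le _))
  have i2 := psi_integral (s := 0) (by norm_num) h0 h1
  simp only [zero_add, one_mul, zero_sub, Real.rpow_neg_one] at i2
  have hdi : IntegrableOn (fun u => a * ((s + 1) * u ^ s) + b * (1 - u)⁻¹) (Ioo 0 v) :=
    (i1.1.const_mul a).add (i2.1.const_mul b)
  have hgi : IntegrableOn g (Ioo 0 v) := by
    refine Integrable.mono' hdi hg.aestronglyMeasurable ?_
    filter_upwards [ae_restrict_mem measurableSet_Ioo] with u hu
    rw [Real.norm_of_nonneg (hg0 u hu.1 (hu.2.trans h1))]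
    exact hgb u hu.1 (hu.2.trans h1)
  refine ⟨hgi, ?_⟩
  calc ∫ u in Ioo 0 v, |g u| ≤ ∫ u in Ioo 0 v, (a * ((s + 1) * u ^ s) + b * (1 - u)⁻¹) := by
        refine setIntegral_mono_on hgi.abs hdi measurableSet_Ioo fun u hu => ?_
        rw [abs_of_nonneg (hg0 u hu.1 (hu.2.trans h1))]
        exact hgb u hu.1 (hu.2.trans h1)
    _ = a * v ^ (s + 1) + b * psiFn 0 v := by
        rw [integral_add (i1.1.const_mul a) (i2.1.const_mul b), integral_const_mul,
          i1.2, integral_const_mul, i2.2, Real.zero_rpow (by linarith), sub_zero]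
    _ ≤ a + b * psiFn 0 v := by
        have : v ^ (s + 1) ≤ 1 := Real.rpow_le_one h0.le h1.le (by linarith)
        nlinarith

lemma W_bound {s : ℝ} (hs : -1 < s) {u : ℝ} (h0 : 0 < u) (h1 : u < 1) :
    0 ≤ 1 - u ^ (s + 1) ∧ 1 - u ^ (s + 1) ≤ (s + 2) * (1 - u) := by
  refine ⟨by linarith [Real.rpow_le_one h0.le h1.le (show 0 ≤ s + 1 by linarith)], ?_⟩
  rcases le_total 1 (s + 1) with h | h
  · have := one_add_mul_self_le_rpow_one_add (s := u - 1) (by linarith) h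
    rw [add_sub_cancel] at this
    nlinarith
  · have : u ^ (1:ℝ) ≤ u ^ (s + 1) := Real.rpow_le_rpow_of_exponent_ge h0 h1.le h
    rw [Real.rpow_one] at this
    nlinarith

lemma kK_bound {s : ℝ} (hs : -1 < s) {u : ℝ} (h0 : 0 < u) (h1 : u < 1) :
    0 ≤ (1 - u ^ (s + 1)) / (1 - u) ^ 2 ∧
    (1 - u ^ (s + 1)) / (1 - u) ^ 2 ≤ 0 * ((s + 1) * u ^ s) + (s + 2) * (1 - u)⁻¹ := by
  obtain ⟨a, b⟩ := W_bound hs h0 h1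
  have hp : 0 < 1 - u := by linarith
  refine ⟨by positivity, ?_⟩
  rw [div_le_iff₀ (by positivity)]
  calc _ ≤ _ := b
    _ = _ := by field_simp; ring

lemma kH_bound {s : ℝ} (hs : -1 < s) {u : ℝ} (h0 : 0 < u) (h1 : u < 1) :
    0 ≤ (s + 1) * u ^ s / (1 - u) ∧
    (s + 1) * u ^ s / (1 - u) ≤ 1 * ((s + 1) * u ^ s) + (s + 1) * (1 - u)⁻¹ := by
  have hp : 0 < 1 - u := by linarith
  have hs' : 0 < s + 1 := by linarith
  refine ⟨by positivity, ?_⟩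
  rw [div_le_iff₀ hp]
  have h : u ^ (s + 1) ≤ 1 := Real.rpow_le_one h0.le h1.le (by linarith)
  rw [Real.rpow_add_one h0.ne'] at h
  have e : (1 * ((s + 1) * u ^ s) + (s + 1) * (1 - u)⁻¹) * (1 - u) =
    (s + 1) * u ^ s * (1 - u) + (s + 1) := by field_simp
  rw [e]
  nlinarith

lemma KH_diff {s : ℝ} (hs : -1 < s) {v : ℝ} (h0 : 0 < v) (h1 : v < 1)
    (hK : IntegrableOn (fun u : ℝ => (1 - u ^ (s + 1)) / (1 - u) ^ 2) (Ioo 0 v))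
    (hH : IntegrableOn (fun u : ℝ => (s + 1) * u ^ s / (1 - u)) (Ioo 0 v)) :
    (∫ u in Ioo 0 v, (1 - u ^ (s + 1)) / (1 - u) ^ 2) - (∫ u in Ioo 0 v, (s + 1) * u ^ s / (1 - u))
      = (1 - v ^ (s + 1)) / (1 - v) - 1 := by
  rw [← integral_sub hK hH, ← integral_Ioc_eq_integral_Ioo, ← intervalIntegral.integral_of_le h0.le,
    intervalIntegral.integral_eq_sub_of_hasDerivAt_of_le
      (f := fun u : ℝ => (1 - u ^ (s + 1)) / (1 - u)) h0.le]
  · simp [Real.zero_rpow (show s + 1 ≠ 0 by linarith)]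
  · refine ContinuousOn.div (continuous_const.sub
      (Real.continuous_rpow_const (by linarith))).continuousOn (by fun_prop) ?_
    intro x hx; have := hx.2; linarith
  · intro x hx
    have hp : 1 - x ≠ 0 := by have := hx.2; linarith
    have d1 : HasDerivAt (fun u : ℝ => 1 - u ^ (s + 1)) (-((s + 1) * x ^ s)) x := by
      have := (Real.hasDerivAt_rpow_const (x := x) (p := s + 1) (Or.inl hx.1.ne')).const_sub 1
      simpa using this
    have d2 : HasDerivAt (fun v : ℝ => 1 - v) (-1) x := by
      simpa using (hasDerivAt_id x).const_sub 1
    refine HasDerivAt.congr_deriv (d1.div d2 hp) ?_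
    field_simp; ring
  · exact (intervalIntegrable_iff_integrableOn_Ioo_of_le h0.le).2 (hK.sub hH)

end part2

/-- **Proposition DN.** Let `s > −1` and `X` integrable with continuous cdf
`F`, tail `F̄` and mean residual life `mrl`. If `Δ̄_s(X) < ∞` then
`E[X] + Δ̄_s(X) = (s+1) E[F̄(X)^s (X + mrl(X))]`, and if `Δ̄_0(X) < ∞` then
`E[X] + ∇̄_s(X) = (s+1) E[F(X)^s (X + mrl(X))]`. -/
theorem risk_measures_mrl_representation
    {Ω : Type*} [MeasureSpace Ω] [IsProbabilityMeasure (volume : Measure Ω)]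
    (X : Ω → ℝ) (hXm : Measurable X) (hXint : Integrable X)
    (F Fb : ℝ → ℝ)
    (hF : ∀ x, F x = ((volume : Measure Ω) {ω | X ω ≤ x}).toReal)
    (hFb : ∀ x, Fb x = ((volume : Measure Ω) {ω | x < X ω}).toReal)
    (hFcont : Continuous F)
    (mrl : ℝ → ℝ)
    (hmrl : ∀ t, mrl t = if 0 < Fb t then (∫ x in Ioi t, Fb x) / Fb t else 0)
    (s : ℝ) (hs : -1 < s) :
    (Integrable (fun x : ℝ => tsallisFn s (Fb x)) (volume : Measure ℝ) →
      (∫ ω, X ω ∂(volume : Measure Ω)) + (∫ x : ℝ, tsallisFn s (Fb x))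
        = (s + 1) * ∫ ω, Fb (X ω) ^ s * (X ω + mrl (X ω)) ∂(volume : Measure Ω))
    ∧ (Integrable (fun x : ℝ => Fb x * Real.log (Fb x)) (volume : Measure ℝ) →
        (∫ ω, X ω ∂(volume : Measure Ω))
            + (∫ ω, ((1 - (1 - Fb (X ω)) ^ (s + 1)) / Fb (X ω)) * mrl (X ω)
                ∂(volume : Measure Ω))
          = (s + 1) * ∫ ω, F (X ω) ^ s * (X ω + mrl (X ω)) ∂(volume : Measure Ω)) := by
  set μ : Measure Ω := volume with hμ
  have hF' : ∀ x, F x = μ.real {ω | X ω ≤ x} := hF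
  have hFb1 : ∀ x, Fb x = μ.real {ω | x < X ω} := hFb
  have hm : Measurable fun ω => F (X ω) := hFcont.measurable.comp hXm
  have hFb2 : ∀ x, Fb x = 1 - F x := by
    intro x
    rw [hFb1, hF', ← probReal_compl_eq_one_sub (measurableSet_le hXm measurable_const)]
    congr 1; ext ω; simp
  let J : Ω → ℝ := fun ω => ∫ ω', {ω' | X ω < X ω'}.indicator X ω' ∂μ
  have hae := unif_ae μ hXm hF' hFcont
  have hmrlX : ∀ᵐ ω ∂μ, mrl (X ω) = J ω / (1 - F (X ω)) - X ω := by
    filter_upwards [hae] with ω hω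
    have hp : 0 < Fb (X ω) := by rw [hFb2]; linarith [hω.2]
    have hp' : 1 - F (X ω) ≠ 0 := by linarith [hω.2]
    have hsl := stop_loss μ hXm hXint (X ω)
    simp only [← hFb1] at hsl
    rw [hmrl, if_pos hp, hsl, hFb2]
    simp only [J]
    field_simp
  constructor
  · intro hT
    simp only [hFb2] at hT ⊢
    obtain ⟨w1, w2⟩ := weighted_mean μ hXm hXint hF' hFcont hs hT
    obtain ⟨-, f2, -⟩ := fubini_mrl μ hXm hF' hFcont
      (κ := fun u => (s + 1) * (1 - u) ^ (s - 1)) (by fun_prop)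
      (fun v h0 h1 => (psi_integral hs h0 h1).1) (B := psiFn s)
      (fun v h0 h1 => by
        rw [← (psi_integral hs h0 h1).2]
        refine le_of_eq (setIntegral_congr_fun measurableSet_Ioo fun u hu => ?_)
        exact abs_of_nonneg (mul_nonneg (by linarith) (Real.rpow_nonneg (by linarith [hu.2]) _)))
      w1
    rw [← w2, ← integral_const_mul]
    have e1 : ∫ ω, X ω * psiFn s (F (X ω)) ∂μ =
        ∫ ω, X ω * (∫ u in Ioo 0 (F (X ω)), (s + 1) * (1 - u) ^ (s - 1)) ∂μ := by
      refine integral_congr_ae ?_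
      filter_upwards [hae] with ω hω
      rw [(psi_integral hs hω.1 hω.2).2]
    rw [e1, ← f2]
    refine integral_congr_ae ?_
    filter_upwards [hae, hmrlX] with ω hω hmω
    have hp' : 1 - F (X ω) ≠ 0 := by linarith [hω.2]
    rw [hmω, Real.rpow_sub_one hp']
    simp only [J]
    ring
  · intro hT
    have hT0 : Integrable (fun x => tsallisFn 0 (1 - F x)) := by
      simp only [hFb2] at hT
      simpa [tsallisFn] using hT.neg
    simp only [hFb2]
    obtain ⟨w1, -⟩ := weighted_mean μ hXm hXint hF' hFcont (s := 0) (by norm_num) hT0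
    have hBi : ∀ a b : ℝ, Integrable (fun ω => X ω * (a + b * psiFn 0 (F (X ω)))) μ := by
      intro a b
      refine ((hXint.mul_const a).add (w1.mul_const b)).congr (Eventually.of_forall fun ω => ?_)
      simp only [Pi.add_apply]; ring
    have mK : Measurable (fun u : ℝ => (1 - u ^ (s + 1)) / (1 - u) ^ 2) := by fun_prop
    have mH : Measurable (fun u : ℝ => (s + 1) * u ^ s / (1 - u)) := by fun_prop
    have bK := fun v (h0 : 0 < v) (h1 : v < 1) => dom_bound hs mK (a := 0) (b := s + 2) le_rfl
      (fun u a b => (kK_bound hs a b).1) (fun u a b => (kK_bound hs a b).2) h0 h1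
    have bH := fun v (h0 : 0 < v) (h1 : v < 1) => dom_bound hs mH (a := 1) (b := s + 1) zero_le_one
      (fun u a b => (kH_bound hs a b).1) (fun u a b => (kH_bound hs a b).2) h0 h1
    obtain ⟨k1, k2, k3⟩ := fubini_mrl μ hXm hF' hFcont mK (fun v h0 h1 => (bK v h0 h1).1)
      (B := fun v => 0 + (s + 2) * psiFn 0 v) (fun v h0 h1 => (bK v h0 h1).2) (hBi _ _)
    obtain ⟨h1, h2, h3⟩ := fubini_mrl μ hXm hF' hFcont mH (fun v h0 h1 => (bH v h0 h1).1)
      (B := fun v => 1 + (s + 1) * psiFn 0 v) (fun v h0 h1 => (bH v h0 h1).2) (hBi _ _)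
    have hW : Integrable (fun ω => (1 - F (X ω) ^ (s + 1)) / (1 - F (X ω)) * X ω) μ := by
      refine hXint.bdd_mul (c := s + 2) (Measurable.aestronglyMeasurable (by fun_prop)) ?_
      filter_upwards [hae] with ω hω
      obtain ⟨a, b⟩ := W_bound hs hω.1 hω.2
      have hp : 0 < 1 - F (X ω) := by linarith [hω.2]
      rw [Real.norm_of_nonneg (by positivity), div_le_iff₀ hp]
      exact b
    have hl : ∫ ω, (1 - (1 - (1 - F (X ω))) ^ (s + 1)) / (1 - F (X ω)) * mrl (X ω) ∂μ =
        ∫ ω, ((1 - F (X ω) ^ (s + 1)) / (1 - F (X ω)) ^ 2 * J ω -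
          (1 - F (X ω) ^ (s + 1)) / (1 - F (X ω)) * X ω) ∂μ := by
      refine integral_congr_ae ?_
      filter_upwards [hae, hmrlX] with ω hω hmω
      have hp' : 1 - F (X ω) ≠ 0 := by linarith [hω.2]
      rw [hmω, sub_sub_cancel]
      field_simp
    have hr : (s + 1) * ∫ ω, F (X ω) ^ s * (X ω + mrl (X ω)) ∂μ =
        ∫ ω, (s + 1) * F (X ω) ^ s / (1 - F (X ω)) * J ω ∂μ := by
      rw [← integral_const_mul]
      refine integral_congr_ae ?_
      filter_upwards [hae, hmrlX] with ω hω hmω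
      have hp' : 1 - F (X ω) ≠ 0 := by linarith [hω.2]
      rw [hmω]
      field_simp
      ring
    have hdiff : ∫ ω, ((1 - F (X ω) ^ (s + 1)) / (1 - F (X ω)) ^ 2 * J ω) ∂μ -
        ∫ ω, (s + 1) * F (X ω) ^ s / (1 - F (X ω)) * J ω ∂μ =
        ∫ ω, (1 - F (X ω) ^ (s + 1)) / (1 - F (X ω)) * X ω ∂μ - ∫ ω, X ω ∂μ := by
      simp only [J]
      rw [k2, h2, ← integral_sub k3 h3, ← integral_sub hW hXint]
      refine integral_congr_ae ?_
      filter_upwards [hae] with ω hω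
      rw [← mul_sub, KH_diff hs hω.1 hω.2 (bK _ hω.1 hω.2).1 (bH _ hω.1 hω.2).1]
      ring
    rw [hl, hr, integral_sub k1 hW]
    linarith
end

section
/- Fix s > −1 and for any integrable real random variable X define ν_s^Δ(X) = E[X] + Δ̄_s(X), where Δ̄_s(X) = (1/s) ∫_ℝ F̄_X(x)(1 − F̄_X(x)^s) dx (and Δ̄_0(X) = −∫ F̄_X log F̄_X). Then ν_s^Δ is a coherent risk measure on the set of integrable X with Δ̄_s(X) < ∞: (i) if F̄_X ≤ F̄_Y pointwise then ν_s^Δ(X) ≤ ν_s^Δ(Y); (ii) ν_s^Δ(aX) = a·ν_s^Δ(X) for every a > 0; (iii) ν_s^Δ(X + b) = ν_s^Δ(X) + b for every b ∈ ℝ; (iv) ν_s^Δ(X + Y) ≤ ν_s^Δ(X) + ν_s^Δ(Y) for any two (not necessarily independent) random variables X, Y defined on the same probability space with Δ̄_s(X), Δ̄_s(Y), Δ̄_s(X+Y) finite. -/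
open MeasureTheory Set

/-- The tail distribution function `F̄_X(x) = P(X > x)`. -/
noncomputable def tailCDF {Ω : Type*} [MeasureSpace Ω] (X : Ω → ℝ) (x : ℝ) : ℝ :=
  ((volume : Measure Ω) {ω | x < X ω}).toReal

/-- The cumulative residual Tsallis entropy `Δ̄_s(X) = (1/s) ∫_ℝ F̄(x)(1 − F̄(x)^s) dx`. -/
noncomputable def cumResTsallis {Ω : Type*} [MeasureSpace Ω] (s : ℝ) (X : Ω → ℝ) : ℝ :=
  ∫ x : ℝ, tsallisFn s (tailCDF X x)

/-- The risk measure `ν_s^Δ(X) = E[X] + Δ̄_s(X)`. -/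
noncomputable def nuDelta {Ω : Type*} [MeasureSpace Ω] (s : ℝ) (X : Ω → ℝ) : ℝ :=
  (∫ ω, X ω) + cumResTsallis s X


noncomputable def stepJ (q x : ℝ) : ℝ := if x < q then 1 else 0

lemma stepJ_meas : Measurable (fun z : ℝ × ℝ => stepJ z.1 z.2) := by
  unfold stepJ
  exact Measurable.ite (measurableSet_lt measurable_snd measurable_fst) measurable_const
    measurable_const

lemma stepJ_meas' (q : ℝ) : Measurable (stepJ q) := by
  unfold stepJ
  exact Measurable.ite measurableSet_Iio measurable_const measurable_const

lemma stepJ_sub_eq (p q : ℝ) : (fun x => stepJ p x - stepJ q x) =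
    fun x => (Ico q p).indicator (fun _ => (1:ℝ)) x - (Ico p q).indicator (fun _ => (1:ℝ)) x := by
  funext x
  simp only [stepJ, indicator, mem_Ico]
  split_ifs <;> grind

lemma stepJ_norm_eq (p q : ℝ) : (fun x => ‖stepJ p x - stepJ q x‖) =
    fun x => (Ico q p).indicator (fun _ => (1:ℝ)) x + (Ico p q).indicator (fun _ => (1:ℝ)) x := by
  funext x
  simp only [stepJ, indicator, mem_Ico, Real.norm_eq_abs]
  split_ifs <;> first | (exfalso; grind) | norm_num

lemma ico_int (p q : ℝ) : Integrable ((Ico q p).indicator (fun _ => (1:ℝ))) volume := by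
  rw [integrable_indicator_iff measurableSet_Ico]
  exact integrableOn_const (by simp)

lemma ico_integral (p q : ℝ) : ∫ x, (Ico q p).indicator (fun _ => (1:ℝ)) x = max (p - q) 0 := by
  rw [integral_indicator measurableSet_Ico]
  simp [Measure.real, Real.volume_Ico, ENNReal.toReal_ofReal']

lemma stepJ_int (p q : ℝ) : Integrable (fun x => stepJ p x - stepJ q x) := by
  rw [stepJ_sub_eq]
  exact (ico_int p q).sub (ico_int q p)

lemma stepJ_integral (p q : ℝ) : ∫ x, (stepJ p x - stepJ q x) = p - q := by
  rw [stepJ_sub_eq, integral_sub (ico_int p q) (ico_int q p), ico_integral, ico_integral]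
  rcases le_total p q with h | h
  · rw [max_eq_right (by linarith), max_eq_left (by linarith)]; ring
  · rw [max_eq_left (by linarith), max_eq_right (by linarith)]; ring

lemma stepJ_norm_integral (p q : ℝ) : ∫ x, ‖stepJ p x - stepJ q x‖ = |p - q| := by
  rw [stepJ_norm_eq, integral_add (ico_int p q) (ico_int q p), ico_integral, ico_integral]
  rcases le_total p q with h | h
  · rw [max_eq_right (by linarith), max_eq_left (by linarith), abs_of_nonpos (by linarith)]; ring
  · rw [max_eq_left (by linarith), max_eq_right (by linarith), abs_of_nonneg (by linarith)]; ring

section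
variable {Ω : Type*} [MeasureSpace Ω] [IsProbabilityMeasure (volume : Measure Ω)]

lemma tail_integral_step (X : Ω → ℝ) (hX : Measurable X) (x q : ℝ) :
    ∫ ω, (stepJ (X ω) x - stepJ q x) = tailCDF X x - stepJ q x := by
  have hm : MeasurableSet {ω | x < X ω} := measurableSet_lt measurable_const hX
  have e : (fun ω => stepJ (X ω) x) = {ω | x < X ω}.indicator (fun _ => (1:ℝ)) := by
    funext ω; simp [stepJ, indicator]
  rw [integral_sub _ (integrable_const _), e, integral_indicator hm]
  · simp [tailCDF, Measure.real]
  · rw [e, integrable_indicator_iff hm]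
    exact integrableOn_const (by simp)

lemma tail_lemma (X : Ω → ℝ) (hX : Measurable X) (hi : Integrable X) (q : ℝ) :
    Integrable (fun x => tailCDF X x - stepJ q x) ∧
      ∫ x, (tailCDF X x - stepJ q x) = (∫ ω, X ω) - q := by
  have hg : Integrable (fun z : Ω × ℝ => stepJ (X z.1) z.2 - stepJ q z.2)
      ((volume : Measure Ω).prod (volume : Measure ℝ)) := by
    rw [integrable_prod_iff]
    · refine ⟨Filter.Eventually.of_forall fun ω => stepJ_int (X ω) q, ?_⟩
      simp only [stepJ_norm_integral]
      exact (hi.sub (integrable_const q)).abs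
    · refine Measurable.aestronglyMeasurable ?_
      exact (stepJ_meas.comp ((hX.comp measurable_fst).prodMk measurable_snd)).sub
        ((stepJ_meas' q).comp measurable_snd)
  have h1 := hg.integral_prod_right
  simp only [tail_integral_step X hX] at h1
  refine ⟨h1, ?_⟩
  have h2 := integral_integral_swap (f := fun ω x => stepJ (X ω) x - stepJ q x) hg
  simp only [tail_integral_step X hX, stepJ_integral] at h2
  rw [← h2, integral_sub hi (integrable_const q)]
  simp

lemma tail_anti (X : Ω → ℝ) : Antitone (tailCDF X) := by
  intro x y h
  exact ENNReal.toReal_mono (measure_ne_top _ _) (measure_mono fun ω hω => lt_of_le_of_lt h hω)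

lemma tail_nonneg (X : Ω → ℝ) (x : ℝ) : 0 ≤ tailCDF X x := ENNReal.toReal_nonneg

lemma tail_le_one (X : Ω → ℝ) (x : ℝ) : tailCDF X x ≤ 1 := measureReal_le_one

lemma tail_eq_cdf (X : Ω → ℝ) (hX : Measurable X) (x : ℝ) :
    tailCDF X x = 1 - ProbabilityTheory.cdf (Measure.map X volume) x := by
  have := Measure.isProbabilityMeasure_map (μ := (volume : Measure Ω)) hX.aemeasurable
  rw [ProbabilityTheory.cdf_eq_real, map_measureReal_apply hX measurableSet_Iic]
  rw [← probReal_compl_eq_one_sub (hX measurableSet_Iic)]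
  simp only [tailCDF, Measure.real]
  congr 2
  ext ω; simp

lemma exists_quantile (X : Ω → ℝ) (hX : Measurable X) (a : ℝ) (h0 : 0 < a) (h1 : a < 1) :
    ∃ q, (∀ x < q, a ≤ tailCDF X x) ∧ (∀ x, q < x → tailCDF X x ≤ a) := by
  have t1 := ProbabilityTheory.tendsto_cdf_atTop (Measure.map X (volume : Measure Ω))
  have t0 := ProbabilityTheory.tendsto_cdf_atBot (Measure.map X (volume : Measure Ω))
  obtain ⟨u, hu⟩ := (t1.eventually (lt_mem_nhds (show 1 - a < 1 by linarith))).exists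
  obtain ⟨v, hv⟩ := (t0.eventually (gt_mem_nhds (show 0 < 1 - a by linarith))).exists
  have hu' : tailCDF X u ≤ a := by rw [tail_eq_cdf X hX]; linarith
  have hv' : a < tailCDF X v := by rw [tail_eq_cdf X hX]; linarith
  have hb : BddBelow {x | tailCDF X x ≤ a} := by
    refine ⟨v, fun x hx => ?_⟩
    by_contra hc
    have := tail_anti X (le_of_not_ge hc)
    have : tailCDF X x ≤ a := hx
    linarith
  refine ⟨sInf {x | tailCDF X x ≤ a}, fun x hx => ?_, fun x hx => ?_⟩
  · by_contra hc
    exact absurd (csInf_le hb (show x ∈ {x | tailCDF X x ≤ a} from (not_le.1 hc).le)) (not_le.2 hx)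
  · obtain ⟨y, hy, hyx⟩ := exists_lt_of_csInf_lt ⟨u, hu'⟩ hx
    exact (tail_anti X hyx.le).trans hy

/-- the comparison integrand -/
noncomputable def gFn (X : Ω → ℝ) (a q x : ℝ) : ℝ :=
  a * (stepJ q x - stepJ 0 x) + (tailCDF (fun ω => max (X ω) q) x - stepJ q x)

lemma gFn_lemma (X : Ω → ℝ) (hX : Measurable X) (hi : Integrable X) (a q : ℝ) :
    Integrable (gFn X a q) ∧ ∫ x, gFn X a q x = a * q + ∫ ω, max (X ω - q) 0 := by
  have hm : Integrable (fun ω => max (X ω) q) := hi.sup (integrable_const q)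
  obtain ⟨k1, k2⟩ := tail_lemma (fun ω => max (X ω) q) (hX.max measurable_const) hm q
  have k3 := (stepJ_int q 0).const_mul a
  refine ⟨k3.add k1, ?_⟩
  unfold gFn
  rw [integral_add k3 k1, k2, integral_const_mul, stepJ_integral]
  have : (fun ω => max (X ω - q) 0) = fun ω => max (X ω) q - q := by
    funext ω; rw [← max_sub_sub_right, sub_self]
  rw [this, integral_sub hm (integrable_const q)]
  simp

lemma gFn_eq_lt (X : Ω → ℝ) (a q x : ℝ) (h : x < q) :
    gFn X a q x = a - a * stepJ 0 x := by
  have : tailCDF (fun ω => max (X ω) q) x = 1 := by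
    simp [tailCDF, h]
  simp only [gFn, this, stepJ, h, if_true]; ring

lemma gFn_eq_ge (X : Ω → ℝ) (a q x : ℝ) (h : q ≤ x) :
    gFn X a q x = tailCDF X x - a * stepJ 0 x := by
  have : tailCDF (fun ω => max (X ω) q) x = tailCDF X x := by
    simp [tailCDF, not_lt.2 h]
  simp only [gFn, this, stepJ, not_lt.2 h, if_false]; ring

/-- the CVaR-type integrand -/
noncomputable def dFn (X : Ω → ℝ) (x a : ℝ) : ℝ := min (tailCDF X x) a - a * stepJ 0 x

lemma dFn_le (X : Ω → ℝ) (a q x : ℝ) : dFn X x a ≤ gFn X a q x := by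
  unfold dFn
  rcases lt_or_ge x q with h | h
  · rw [gFn_eq_lt X a q x h]; linarith [min_le_right (tailCDF X x) a]
  · rw [gFn_eq_ge X a q x h]; linarith [min_le_left (tailCDF X x) a]

lemma dFn_ae (X : Ω → ℝ) (hX : Measurable X) (a : ℝ) (h0 : 0 < a) (h1 : a < 1) :
    ∃ q, (fun x => dFn X x a) =ᵐ[volume] gFn X a q := by
  obtain ⟨q, hq1, hq2⟩ := exists_quantile X hX a h0 h1
  refine ⟨q, ?_⟩
  filter_upwards [Measure.ae_ne volume q] with x hx
  unfold dFn
  rcases lt_or_gt_of_ne hx with h | h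
  · rw [gFn_eq_lt X a q x h, min_eq_right (hq1 x h)]
  · rw [gFn_eq_ge X a q x h.le, min_eq_left (hq2 x h)]

lemma dFn_int (X : Ω → ℝ) (hX : Measurable X) (hi : Integrable X) (a : ℝ) (h0 : 0 < a)
    (h1 : a < 1) : Integrable (fun x => dFn X x a) := by
  obtain ⟨q, hq⟩ := dFn_ae X hX a h0 h1
  exact (gFn_lemma X hX hi a q).1.congr hq.symm

lemma dFn_subadd (X Y : Ω → ℝ) (hX : Measurable X) (hi : Integrable X)
    (hY : Measurable Y) (hiY : Integrable Y) (a : ℝ) (h0 : 0 < a) (h1 : a < 1) :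
    ∫ x, dFn (fun ω => X ω + Y ω) x a ≤ (∫ x, dFn X x a) + ∫ x, dFn Y x a := by
  obtain ⟨q, hq⟩ := dFn_ae X hX a h0 h1
  obtain ⟨r, hr⟩ := dFn_ae Y hY a h0 h1
  have hs := gFn_lemma (fun ω => X ω + Y ω) (hX.add hY) (hi.add hiY) a (q + r)
  have hm : ∀ (Z : Ω → ℝ) (p : ℝ), Integrable Z → Integrable (fun ω => max (Z ω - p) 0) :=
    fun Z p hZ => (hZ.sub (integrable_const p)).sup (integrable_const 0)
  calc ∫ x, dFn (fun ω => X ω + Y ω) x a ≤ ∫ x, gFn (fun ω => X ω + Y ω) a (q + r) x :=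
        integral_mono (dFn_int _ (hX.add hY) (hi.add hiY) a h0 h1) hs.1
          (fun x => dFn_le _ _ _ _)
    _ = a * (q + r) + ∫ ω, max (X ω + Y ω - (q + r)) 0 := hs.2
    _ ≤ a * (q + r) + ∫ ω, (max (X ω - q) 0 + max (Y ω - r) 0) := by
        refine add_le_add le_rfl ?_
        refine integral_mono (hm (fun ω => X ω + Y ω) (q + r) (hi.add hiY)) ((hm X q hi).add (hm Y r hiY)) fun ω => ?_
        have := le_max_left (X ω - q) 0
        have := le_max_left (Y ω - r) 0
        have := le_max_right (X ω - q) 0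
        have := le_max_right (Y ω - r) 0
        exact max_le (by linarith) (by linarith)
    _ = _ := by
        rw [integral_add (hm X q hi) (hm Y r hiY), integral_congr_ae hq, integral_congr_ae hr,
          (gFn_lemma X hX hi a q).2, (gFn_lemma Y hY hiY a r).2]
        ring
end

/-! The distortion -/

lemma kernel_int (s : ℝ) (hs : -1 < s) (t : ℝ) (ht0 : 0 ≤ t) :
    IntegrableOn (fun a : ℝ => min t a * a ^ (s - 1)) (Ioo 0 1) := by
  have h : IntegrableOn (fun a : ℝ => a ^ s) (Ioo 0 1) :=
    ((intervalIntegrable_iff_integrableOn_Ioo_of_le zero_le_one).1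
      (intervalIntegral.intervalIntegrable_rpow' hs))
  refine Integrable.mono' h ?_ ?_
  · exact Measurable.aestronglyMeasurable (by fun_prop)
  · filter_upwards [ae_restrict_mem measurableSet_Ioo] with a ha
    have h1 : a ^ s = a * a ^ (s - 1) := by
      rw [Real.rpow_sub_one ha.1.ne']; field_simp [ha.1.ne']
    have h2 : 0 ≤ a ^ (s - 1) := Real.rpow_nonneg ha.1.le _
    rw [Real.norm_eq_abs, abs_of_nonneg (mul_nonneg (le_min ht0 ha.1.le) h2), h1]
    gcongr
    exact min_le_right _ _

lemma kernel_integral (s : ℝ) (hs : -1 < s) (t : ℝ) (ht0 : 0 ≤ t) (ht1 : t ≤ 1) :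
    (s + 1) * ∫ a in Ioo (0:ℝ) 1, min t a * a ^ (s - 1) = t + tsallisFn s t := by
  rcases ht0.eq_or_lt with rfl | ht
  · have : ∫ a in Ioo (0:ℝ) 1, min 0 a * a ^ (s - 1) = 0 := by
      rw [setIntegral_congr_fun (g := fun _ => (0:ℝ)) measurableSet_Ioo]
      · simp
      · intro a ha; simp [min_eq_left ha.1.le]
    rw [this]; simp [tsallisFn]
  have hk := kernel_int s hs t ht0
  have hk' := (intervalIntegrable_iff_integrableOn_Ioo_of_le zero_le_one).2 hk
  rw [← integral_Ioc_eq_integral_Ioo, ← intervalIntegral.integral_of_le zero_le_one,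
    ← intervalIntegral.integral_add_adjacent_intervals (b := t)
      (hk'.mono_set (by rw [uIcc_of_le ht0, uIcc_of_le zero_le_one]; exact Icc_subset_Icc le_rfl ht1))
      (hk'.mono_set (by rw [uIcc_of_le ht1, uIcc_of_le zero_le_one]; exact Icc_subset_Icc ht0 le_rfl))]
  have e1 : ∫ a in (0:ℝ)..t, min t a * a ^ (s - 1) = ∫ a in (0:ℝ)..t, a ^ s := by
    rw [intervalIntegral.integral_of_le ht0, intervalIntegral.integral_of_le ht0]
    refine setIntegral_congr_fun measurableSet_Ioc fun a ha => ?_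
    simp only [min_eq_right ha.2]
    rw [Real.rpow_sub_one ha.1.ne']; field_simp [ha.1.ne']
  have e2 : ∫ a in t..(1:ℝ), min t a * a ^ (s - 1) = t * ∫ a in t..(1:ℝ), a ^ (s - 1) := by
    rw [← intervalIntegral.integral_const_mul]
    refine intervalIntegral.integral_congr fun a ha => ?_
    rw [uIcc_of_le ht1] at ha
    simp only [min_eq_left ha.1]
  have hn : (0:ℝ) ∉ uIcc t 1 := by rw [uIcc_of_le ht1]; exact fun h => absurd h.1 (not_le.2 ht)
  have hs1 : s + 1 ≠ 0 := by linarith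
  rw [e1, e2, integral_rpow (Or.inl hs), Real.zero_rpow hs1]
  unfold tsallisFn
  split_ifs with h
  · subst h
    have : ∫ a in t..(1:ℝ), a ^ ((0:ℝ) - 1) = ∫ a in t..(1:ℝ), a⁻¹ := by
      congr 1; funext a; rw [zero_sub, Real.rpow_neg_one]
    rw [this, integral_inv hn]
    simp
  · rw [integral_rpow (Or.inr ⟨by intro h'; apply h; linarith, hn⟩)]
    rw [sub_add_cancel, Real.one_rpow, Real.rpow_add ht, Real.rpow_one]
    field_simp
    ring

lemma kernel_one (s : ℝ) (hs : -1 < s) :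
    (s + 1) * ∫ a in Ioo (0:ℝ) 1, a * a ^ (s - 1) = 1 := by
  have := kernel_integral s hs 1 zero_le_one le_rfl
  have h1 : tsallisFn s 1 = 0 := by simp [tsallisFn]
  rw [h1, add_zero] at this
  refine Eq.trans ?_ this
  congr 1
  refine setIntegral_congr_fun measurableSet_Ioo fun a ha => ?_
  simp only [min_eq_right ha.2.le]

lemma kernel_one_int (s : ℝ) (hs : -1 < s) :
    IntegrableOn (fun a : ℝ => a * a ^ (s - 1)) (Ioo 0 1) := by
  refine (kernel_int s hs 1 zero_le_one).congr_fun (fun a (ha : a ∈ Ioo (0:ℝ) 1) => ?_) measurableSet_Ioo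
  simp only [min_eq_right ha.2.le]

lemma distort_mono (s : ℝ) (hs : -1 < s) (t u : ℝ) (ht0 : 0 ≤ t) (htu : t ≤ u) (hu : u ≤ 1) :
    t + tsallisFn s t ≤ u + tsallisFn s u := by
  rw [← kernel_integral s hs t ht0 (htu.trans hu), ← kernel_integral s hs u (ht0.trans htu) hu]
  refine mul_le_mul_of_nonneg_left ?_ (by linarith)
  refine setIntegral_mono_on (kernel_int s hs t ht0) (kernel_int s hs u (ht0.trans htu))
    measurableSet_Ioo fun a ha => ?_
  have h2 : 0 ≤ a ^ (s - 1) := Real.rpow_nonneg ha.1.le _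
  gcongr

section
variable {Ω : Type*} [MeasureSpace Ω] [IsProbabilityMeasure (volume : Measure Ω)]

lemma nu_eq (s : ℝ) (X : Ω → ℝ) (hX : Measurable X) (hi : Integrable X)
    (hT : Integrable (fun x : ℝ => tsallisFn s (tailCDF X x)) (volume : Measure ℝ)) :
    Integrable (fun x => tailCDF X x - stepJ 0 x + tsallisFn s (tailCDF X x)) ∧
    nuDelta s X = ∫ x, (tailCDF X x - stepJ 0 x + tsallisFn s (tailCDF X x)) := by
  obtain ⟨h1, h2⟩ := tail_lemma X hX hi 0
  refine ⟨h1.add hT, ?_⟩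
  rw [integral_add h1 hT, h2, sub_zero]; rfl

lemma slice (s : ℝ) (hs : -1 < s) (X : Ω → ℝ) (x : ℝ) :
    IntegrableOn (fun a => dFn X x a * a ^ (s - 1)) (Ioo 0 1) ∧
    (s + 1) * ∫ a in Ioo (0:ℝ) 1, dFn X x a * a ^ (s - 1) =
      tailCDF X x - stepJ 0 x + tsallisFn s (tailCDF X x) := by
  have k1 := kernel_int s hs _ (tail_nonneg X x)
  have k2 := (kernel_one_int s hs).mul_const (stepJ 0 x)
  have e : (fun a => dFn X x a * a ^ (s - 1)) =
      fun a => min (tailCDF X x) a * a ^ (s - 1) - a * a ^ (s - 1) * stepJ 0 x := by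
    funext a; unfold dFn; ring
  rw [e]
  refine ⟨k1.sub k2, ?_⟩
  rw [integral_sub k1 k2, integral_mul_const, mul_sub, ← mul_assoc, kernel_one s hs,
    kernel_integral s hs _ (tail_nonneg X x) (tail_le_one X x)]
  ring

lemma prod_int (s : ℝ) (hs : -1 < s) (X : Ω → ℝ) (hX : Measurable X) (hi : Integrable X)
    (hT : Integrable (fun x : ℝ => tsallisFn s (tailCDF X x)) (volume : Measure ℝ)) :
    Integrable (fun z : ℝ × ℝ => dFn X z.1 z.2 * z.2 ^ (s - 1))
      ((volume : Measure ℝ).prod (volume.restrict (Ioo (0:ℝ) 1))) := by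
  rw [integrable_prod_iff]
  · refine ⟨Filter.Eventually.of_forall fun x => (slice s hs X x).1, ?_⟩
    have hn : ∀ x, ∫ a in Ioo (0:ℝ) 1, ‖dFn X x a * a ^ (s - 1)‖ =
        (s + 1)⁻¹ * ((1 - 2 * stepJ 0 x) *
          (tailCDF X x - stepJ 0 x + tsallisFn s (tailCDF X x))) := by
      intro x
      rw [← (slice s hs X x).2, mul_left_comm, inv_mul_cancel_left₀ (by linarith),
        ← integral_const_mul]
      refine setIntegral_congr_fun measurableSet_Ioo fun a ha => ?_
      have h2 : 0 ≤ a ^ (s - 1) := Real.rpow_nonneg ha.1.le _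
      simp only [norm_mul, Real.norm_eq_abs, abs_of_nonneg h2]
      rw [← mul_assoc]
      congr 1
      unfold dFn stepJ
      split_ifs
      · rw [abs_of_nonpos (by linarith [min_le_right (tailCDF X x) a])]; ring
      · rw [abs_of_nonneg (by linarith [le_min (tail_nonneg X x) ha.1.le])]; ring
    simp only [hn]
    refine Integrable.const_mul ?_ _
    refine (nu_eq s X hX hi hT).1.bdd_mul (c := 1) ?_ ?_
    · exact (measurable_const.sub (measurable_const.mul (stepJ_meas' 0))).aestronglyMeasurable
    · refine Filter.Eventually.of_forall fun x => ?_
      unfold stepJ; split_ifs <;> norm_num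
  · have h1 := (tail_anti X).measurable
    have h2 := stepJ_meas' 0
    refine Measurable.aestronglyMeasurable ?_
    unfold dFn
    fun_prop

lemma nu_mix (s : ℝ) (hs : -1 < s) (X : Ω → ℝ) (hX : Measurable X) (hi : Integrable X)
    (hT : Integrable (fun x : ℝ => tsallisFn s (tailCDF X x)) (volume : Measure ℝ)) :
    IntegrableOn (fun a => (∫ x, dFn X x a) * a ^ (s - 1)) (Ioo 0 1) ∧
    nuDelta s X = (s + 1) * ∫ a in Ioo (0:ℝ) 1, (∫ x, dFn X x a) * a ^ (s - 1) := by
  have hp := prod_int s hs X hX hi hT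
  have h1 := hp.integral_prod_right
  simp only [integral_mul_const] at h1
  refine ⟨h1, ?_⟩
  rw [(nu_eq s X hX hi hT).2]
  simp only [← (slice s hs X _).2]
  rw [integral_const_mul,
    integral_integral_swap (f := fun x a => dFn X x a * a ^ (s - 1)) hp]
  simp only [integral_mul_const]
end

/-- **Theorem Cohe for `ν_s^Δ`.** For every `s > −1`, the functional
`ν_s^Δ(X) = E[X] + Δ̄_s(X)` is a coherent risk measure on integrable random variables with
`Δ̄_s(X) < ∞`: it is monotone for the stochastic order, positively homogeneous, translation
invariant, and subadditive. -/
theorem nuDelta_coherent_risk_measure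
    {Ω : Type*} [MeasureSpace Ω] [IsProbabilityMeasure (volume : Measure Ω)]
    (s : ℝ) (hs : -1 < s) :
    (∀ X Y : Ω → ℝ, Measurable X → Measurable Y → Integrable X → Integrable Y →
      Integrable (fun x : ℝ => tsallisFn s (tailCDF X x)) (volume : Measure ℝ) →
      Integrable (fun x : ℝ => tsallisFn s (tailCDF Y x)) (volume : Measure ℝ) →
      (∀ x, tailCDF X x ≤ tailCDF Y x) → nuDelta s X ≤ nuDelta s Y)
    ∧ (∀ X : Ω → ℝ, Measurable X → Integrable X →
        Integrable (fun x : ℝ => tsallisFn s (tailCDF X x)) (volume : Measure ℝ) →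
        ∀ a : ℝ, 0 < a → nuDelta s (fun ω => a * X ω) = a * nuDelta s X)
    ∧ (∀ X : Ω → ℝ, Measurable X → Integrable X →
        Integrable (fun x : ℝ => tsallisFn s (tailCDF X x)) (volume : Measure ℝ) →
        ∀ b : ℝ, nuDelta s (fun ω => X ω + b) = nuDelta s X + b)
    ∧ (∀ X Y : Ω → ℝ, Measurable X → Measurable Y → Integrable X → Integrable Y →
        Integrable (fun x : ℝ => tsallisFn s (tailCDF X x)) (volume : Measure ℝ) →
        Integrable (fun x : ℝ => tsallisFn s (tailCDF Y x)) (volume : Measure ℝ) →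
        Integrable (fun x : ℝ => tsallisFn s (tailCDF (fun ω => X ω + Y ω) x))
          (volume : Measure ℝ) →
        nuDelta s (fun ω => X ω + Y ω) ≤ nuDelta s X + nuDelta s Y) := by
  refine ⟨?_, ?_, ?_, ?_⟩
  · intro X Y hX hY hiX hiY hTX hTY hle
    obtain ⟨x1, x2⟩ := nu_eq s X hX hiX hTX
    obtain ⟨y1, y2⟩ := nu_eq s Y hY hiY hTY
    rw [x2, y2]
    refine integral_mono x1 y1 fun x => ?_
    have := distort_mono s hs _ _ (tail_nonneg X x) (hle x) (tail_le_one Y x)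
    simp only
    linarith
  · intro X hX hi hT a ha
    have e : ∀ x, tailCDF (fun ω => a * X ω) x = tailCDF X (x / a) := by
      intro x
      simp only [tailCDF, div_lt_iff₀' ha]
    simp only [nuDelta, cumResTsallis, e]
    rw [Measure.integral_comp_div (fun x => tsallisFn s (tailCDF X x)) a, integral_const_mul,
      abs_of_pos ha, smul_eq_mul]
    ring
  · intro X hX hi hT b
    have e : ∀ x, tailCDF (fun ω => X ω + b) x = tailCDF X (x - b) := by
      intro x
      simp only [tailCDF, sub_lt_iff_lt_add]
    simp only [nuDelta, cumResTsallis, e]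
    rw [integral_sub_right_eq_self (fun x => tsallisFn s (tailCDF X x)) b,
      integral_add hi (integrable_const b)]
    simp
    ring
  · intro X Y hX hY hiX hiY hTX hTY hTZ
    obtain ⟨x1, x2⟩ := nu_mix s hs X hX hiX hTX
    obtain ⟨y1, y2⟩ := nu_mix s hs Y hY hiY hTY
    obtain ⟨z1, z2⟩ := nu_mix s hs (fun ω => X ω + Y ω) (hX.add hY) (hiX.add hiY) hTZ
    rw [x2, y2, z2, ← mul_add, ← integral_add x1 y1]
    refine mul_le_mul_of_nonneg_left ?_ (by linarith)
    refine setIntegral_mono_on z1 (x1.add y1) measurableSet_Ioo fun a ha => ?_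
    have h2 : 0 ≤ a ^ (s - 1) := Real.rpow_nonneg ha.1.le _
    have := dFn_subadd X Y hX hiX hY hiY a ha.1 ha.2
    have := mul_le_mul_of_nonneg_right this h2
    rw [add_mul] at this
    exact this
end
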